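/- Let G be a 2-connected graph on n vertices and let < be any total order on its edge set. Then γ₂(G,<) = 0 (equivalently, n_1(G,<) = 2·cy(G)·(cy(G)+2)) if and only if either n < 5, or n ≥ 5 and G is isomorphic to the graph G_n or to the complete bipartite graph K_{2,n−2}. -/

import Mathlib

open SimpleGraph Finset Filter

namespace SEP

/-- The vector `e_i - e_j` in `ℝ^n`. -/
def eVec {n : ℕ} (i j : Fin n) : Fin n → ℝ :=
  fun t => (if t = i then 1 else 0) - (if t = j then 1 else 0)

/-- The symmetric edge polytope of a graph on `Fin n`. -/
def symEdgePolytope {n : ℕ} (G : SimpleGraph (Fin n)) : Set (Fin n → ℝ) :=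
  convexHull ℝ {x | ∃ i j, G.Adj i j ∧ x = eVec i j}

/-- Both darts `a` and `b` are arcs of a common directed cycle of length `m` of `G`. -/
def dartsInCycle {V : Type*} (G : SimpleGraph V) (a b : G.Dart) (m : ℕ) : Prop :=
  ∃ (u : V) (w : G.Walk u u), w.IsCycle ∧ w.length = m ∧ a ∈ w.darts ∧ b ∈ w.darts

/-- `F` is a face of the polytope `P`: the set of maximizers of some linear functional. -/
def IsFaceOfPolytope {n : ℕ} (P F : Set (Fin n → ℝ)) : Prop :=
  ∃ a : Fin n → ℝ,
    F = {x | x ∈ P ∧ ∀ y ∈ P, ∑ t, a t * y t ≤ ∑ t, a t * x t}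

/-- Dimension of (the affine span of) a subset of `ℝ^n`. -/
noncomputable def polyDim {n : ℕ} (s : Set (Fin n → ℝ)) : ℕ :=
  Module.finrank ℝ (vectorSpan ℝ s)

/-- `v` is a vertex of the polytope `P`. -/
def IsVertexOfPolytope {n : ℕ} (P : Set (Fin n → ℝ)) (v : Fin n → ℝ) : Prop :=
  IsFaceOfPolytope P {v}

/-- `F` is an edge (a 1-dimensional face) of the polytope `P`. -/
def IsEdgeOfPolytope {n : ℕ} (P F : Set (Fin n → ℝ)) : Prop :=
  IsFaceOfPolytope P F ∧ polyDim F = 1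

/-- A polytope is simple if every vertex lies on exactly `dim P` edges. -/
def IsSimplePolytope {n : ℕ} (P : Set (Fin n → ℝ)) : Prop :=
  ∀ v, IsVertexOfPolytope P v →
    Set.ncard {F : Set (Fin n → ℝ) | IsEdgeOfPolytope P F ∧ v ∈ F} = polyDim P

/-- Two disjoint edges, on four vertices. -/
def twoDisjointEdges : SimpleGraph (Fin 4) :=
  SimpleGraph.fromEdgeSet {s(0, 1), s(2, 3)}

/-- The cyclomatic number `|E| - |V| + c` of a graph, as an integer. -/
noncomputable def cyc {V : Type*} (G : SimpleGraph V) : ℤ :=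
  (G.edgeSet.ncard : ℤ) + Nat.card G.ConnectedComponent - Nat.card V

/-- A graph is 2-connected: connected, with at least 3 vertices, and deleting any
single vertex leaves it connected. -/
def TwoConnected {V : Type*} (G : SimpleGraph V) : Prop :=
  G.Connected ∧ 3 ≤ Nat.card V ∧ ∀ v : V, (G.induce {u | u ≠ v}).Connected

/-- The subgraph `H` consists of a single edge of `G`. -/
def IsSingleEdge {V : Type*} (G : SimpleGraph V) (H : G.Subgraph) : Prop :=
  ∃ (u v : V) (h : G.Adj u v), H = G.subgraphOfAdj h

/-- `H` is a 2-connected component (block) of `G`: an inclusion-maximal subgraph that is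
2-connected or a single edge. -/
def IsBlock {V : Type*} (G : SimpleGraph V) (H : G.Subgraph) : Prop :=
  (TwoConnected H.coe ∨ IsSingleEdge G H) ∧
    ∀ H' : G.Subgraph, H ≤ H' → (TwoConnected H'.coe ∨ IsSingleEdge G H') → H' = H

/-- A pair of darts (oriented edges) of `G`, with distinct underlying edges, is *bad*
with respect to the order `elt` on edges. -/
def BadPair {V : Type*} (G : SimpleGraph V) (elt : Sym2 V → Sym2 V → Prop)
    (a b : G.Dart) : Prop :=
  a.edge ≠ b.edge ∧
    (dartsInCycle G a b 3 ∨
      ∃ (u : V) (w : G.Walk u u), w.IsCycle ∧ w.length = 4 ∧ a ∈ w.darts ∧ b ∈ w.darts ∧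
        (∃ e ∈ w.edges, elt e a.edge) ∧ (∃ e ∈ w.edges, elt e b.edge))

/-- `n₁(G, <)`: the number of (unordered) bad pairs of oriented edges. -/
noncomputable def n1 {V : Type*} (G : SimpleGraph V) (elt : Sym2 V → Sym2 V → Prop) : ℕ :=
  Set.ncard {z : Sym2 G.Dart | ∃ a b, BadPair G elt a b ∧ z = s(a, b)}

/-- `γ₂(G, <) = 2 cy(G)(cy(G)+2) - n₁(G, <)`. -/
noncomputable def gammaTwo {V : Type*} (G : SimpleGraph V)
    (elt : Sym2 V → Sym2 V → Prop) : ℤ :=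
  2 * cyc G * (cyc G + 2) - (n1 G elt : ℤ)

/-- Restriction of an order on `Sym2 V` to `Sym2 s` for `s : Set V`. -/
def restrictOrd {V : Type*} (elt : Sym2 V → Sym2 V → Prop) (s : Set V) :
    Sym2 s → Sym2 s → Prop :=
  fun e₁ e₂ => elt (e₁.map Subtype.val) (e₂.map Subtype.val)

/-- The graph `G_n` on `Fin n`: vertices `0` and `1` are adjacent to everything. -/
def GnGraph (n : ℕ) : SimpleGraph (Fin n) :=
  SimpleGraph.fromRel (fun a _ => a.val < 2)

/-- The complete bipartite graph `K_{2, n-2}` on `Fin n`, with parts `{0,1}` and the rest. -/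
def K2Graph (n : ℕ) : SimpleGraph (Fin n) :=
  SimpleGraph.fromRel (fun a b => a.val < 2 ∧ 2 ≤ b.val)

/-- A set `S` of darts of `G` is a face of the triangulation `Δ_<` of `∂P_G`. -/
def IsFace {V : Type*} (G : SimpleGraph V) (elt : Sym2 V → Sym2 V → Prop)
    (S : Set G.Dart) : Prop :=
  (¬ ∃ d ∈ S, d.symm ∈ S) ∧
    ∀ ℓ : ℕ, 2 ≤ ℓ → ∀ (u : V) (w : G.Walk u u), w.IsCycle →
      (w.length = 2 * ℓ - 1 → Set.ncard {d ∈ S | d ∈ w.darts} < ℓ) ∧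
      (w.length = 2 * ℓ →
        Set.ncard {d ∈ S | d ∈ w.darts ∧ ∃ e ∈ w.edges, elt e d.edge} < ℓ)

/-- The face complex `Δ_<` of `(G, <)`. -/
def faceCx {V : Type*} (G : SimpleGraph V) (elt : Sym2 V → Sym2 V → Prop) :
    Set (Set G.Dart) :=
  {S | IsFace G elt S}

/-- The join of two simplicial complexes (given as families of faces on disjoint
vertex types). -/
def joinCx {A B : Type*} (F : Set (Set A)) (H : Set (Set B)) : Set (Set (A ⊕ B)) :=
  {S | ∃ F₁ ∈ F, ∃ H₁ ∈ H, S = Sum.inl '' F₁ ∪ Sum.inr '' H₁}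

/-- The complex consisting of two disjoint vertices. -/
def twoPtCx : Set (Set (Fin 2)) :=
  {S | S = ∅ ∨ S = {0} ∨ S = {1}}

/-- Contraction of the edge `{v, w}` of a simplicial complex; `v` is identified with `w`. -/
def contractCx {A : Type*} (F : Set (Set A)) (v w : A) : Set (Set A) :=
  {S | (S ∈ F ∧ v ∉ S) ∨ ∃ H ∈ F, v ∈ H ∧ S = (H \ {v}) ∪ {w}}

/-- Isomorphism of simplicial complexes: a bijection of vertex sets inducing a bijection
of faces. -/
def CxIso {A B : Type*} (F : Set (Set A)) (H : Set (Set B)) : Prop :=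
  ∃ φ : A → B, Set.BijOn φ (⋃₀ F) (⋃₀ H) ∧
    (∀ S ∈ F, φ '' S ∈ H) ∧ (∀ T ∈ H, ∃ S ∈ F, φ '' S = T)

/-! ### Erdős–Rényi random graphs -/

/-- The probability weight of a fixed graph `G` in the Erdős–Rényi model `G(n,p)`. -/
noncomputable def graphWeight (n : ℕ) (p : ℝ) (G : SimpleGraph (Fin n)) : ℝ :=
  p ^ G.edgeSet.ncard * (1 - p) ^ (n.choose 2 - G.edgeSet.ncard)

/-- The probability of an event `A` in the Erdős–Rényi model `G(n,p)`. -/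
noncomputable def erProb (n : ℕ) (p : ℝ) (A : Set (SimpleGraph (Fin n))) : ℝ :=
  ∑ G : SimpleGraph (Fin n), A.indicator (graphWeight n p) G

/-- The expectation of a random variable in the Erdős–Rényi model `G(n,p)`. -/
noncomputable def erExp (n : ℕ) (p : ℝ) (X : SimpleGraph (Fin n) → ℝ) : ℝ :=
  ∑ G : SimpleGraph (Fin n), graphWeight n p G * X G

/-- The variance of a random variable in the Erdős–Rényi model `G(n,p)`. -/
noncomputable def erVar (n : ℕ) (p : ℝ) (X : SimpleGraph (Fin n) → ℝ) : ℝ :=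
  erExp n p (fun G => (X G - erExp n p X) ^ 2)

/-- The number of cycles of `G` with exactly `k` vertices, counted via their edge sets. -/
noncomputable def numCycles {V : Type*} (G : SimpleGraph V) (k : ℕ) : ℕ :=
  Set.ncard {s : Set (Sym2 V) |
    ∃ (u : V) (w : G.Walk u u), w.IsCycle ∧ w.length = k ∧ s = {e | e ∈ w.edges}}

/-- `E(X_k) = C(n,k)·((k−1)!/2)·p^k`, the expected number of `k`-cycles. -/
noncomputable def expCycles (n : ℕ) (p : ℝ) (k : ℕ) : ℝ :=
  (n.choose k : ℝ) * ((Nat.factorial (k - 1) : ℝ) / 2) * p ^ k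

/-- `E(X_E) = C(n,2)·p`, the expected number of edges. -/
noncomputable def expEdges (n : ℕ) (p : ℝ) : ℝ :=
  (n.choose 2 : ℝ) * p

/-- `n_{k-1}(G)`: the number of `k`-element non-faces of `Δ_<` containing no antipodal
pair. -/
noncomputable def numNonFaces {V : Type*} (G : SimpleGraph V)
    (elt : Sym2 V → Sym2 V → Prop) (k : ℕ) : ℕ :=
  Set.ncard {S : Set G.Dart |
    S.ncard = k ∧ (¬ ∃ d ∈ S, d.symm ∈ S) ∧ ¬ IsFace G elt S}

/-- `f_{k-1}(G)`: the number of `k`-element faces of `Δ_<`. -/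
noncomputable def numFaces {V : Type*} (G : SimpleGraph V)
    (elt : Sym2 V → Sym2 V → Prop) (k : ℕ) : ℕ :=
  Set.ncard {S : Set G.Dart | S.ncard = k ∧ IsFace G elt S}

/-- The generalized binomial coefficient `binom(x, ℓ)` for real `x`. -/
noncomputable def realChoose (x : ℝ) (ℓ : ℕ) : ℝ :=
  (∏ i ∈ Finset.range ℓ, (x - i)) / (Nat.factorial ℓ)

/-- The recursively defined γ-numbers `γ_ℓ(G)`:
`γ_0 = 1` and
`γ_ℓ = f_{ℓ−1} − [t^{n−1−ℓ}] ∑_{i<ℓ} γ_i (t+1)^i (t+2)^{n−1−2i}`. -/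
noncomputable def gammaRG (n : ℕ) (G : SimpleGraph (Fin n))
    (elt : Sym2 (Fin n) → Sym2 (Fin n) → Prop) : ℕ → ℤ := fun ℓ =>
  Nat.strongRecOn ℓ (fun ℓ ih =>
    if ℓ = 0 then (1 : ℤ)
    else
      (numFaces G elt ℓ : ℤ) -
        Polynomial.coeff
          (∑ i ∈ (Finset.range ℓ).attach,
            Polynomial.C (ih i.1 (Finset.mem_range.mp i.2)) *
              ((Polynomial.X + 1) ^ (i.1 : ℕ) *
                (Polynomial.X + 2) ^ (n - 1 - 2 * i.1) : Polynomial ℤ))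
          (n - 1 - ℓ))

section AdjPairs

variable {V : Type*}

open Classical in
/-- The ordered pairs of adjacent vertices in `A × B`. -/
noncomputable def adjPairs (G : SimpleGraph V) (A B : Finset V) : Finset (V × V) :=
  {p ∈ A ×ˢ B | G.Adj p.1 p.2}

@[simp]
lemma mem_adjPairs {G : SimpleGraph V} {A B : Finset V} {p : V × V} :
    p ∈ adjPairs G A B ↔ (p.1 ∈ A ∧ p.2 ∈ B) ∧ G.Adj p.1 p.2 := by
  simp [adjPairs]

end AdjPairs

section Cyclomatic

variable {V : Type*} {G : SimpleGraph V}

lemma reachable_deleteEdges_or {u v x y : V} (h : G.Reachable x y) :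
    (G.deleteEdges {s(u, v)}).Reachable x y ∨
      ((G.deleteEdges {s(u, v)}).Reachable x u ∨ (G.deleteEdges {s(u, v)}).Reachable x v) ∧
      ((G.deleteEdges {s(u, v)}).Reachable y u ∨ (G.deleteEdges {s(u, v)}).Reachable y v) := by
  obtain ⟨p⟩ := h
  induction p with
  | nil => exact Or.inl (Reachable.refl _)
  | @cons x z y h p ih =>
    by_cases he : s(x, z) = s(u, v)
    · have hx : (G.deleteEdges {s(u, v)}).Reachable x u ∨
          (G.deleteEdges {s(u, v)}).Reachable x v := by
        rcases Sym2.eq_iff.1 he with ⟨rfl, rfl⟩ | ⟨rfl, rfl⟩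
        · exact Or.inl (Reachable.refl _)
        · exact Or.inr (Reachable.refl _)
      refine Or.inr ⟨hx, ?_⟩
      rcases ih with ih | ih
      · rcases Sym2.eq_iff.1 he with ⟨rfl, rfl⟩ | ⟨rfl, rfl⟩
        · exact Or.inr ih.symm
        · exact Or.inl ih.symm
      · exact ih.2
    · have hxz : (G.deleteEdges {s(u, v)}).Reachable x z :=
        (deleteEdges_adj.2 ⟨h, by simpa using he⟩).reachable
      rcases ih with ih | ⟨ih, ih'⟩
      · exact Or.inl (hxz.trans ih)
      · exact Or.inr ⟨ih.imp hxz.trans hxz.trans, ih'⟩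

variable [Fintype V]

lemma card_connectedComponent_deleteEdges_le (u v : V) :
    Nat.card (G.deleteEdges {s(u, v)}).ConnectedComponent ≤ Nat.card G.ConnectedComponent + 1 := by
  classical
  set G' := G.deleteEdges {s(u, v)} with hG'
  rw [← Finite.card_option]
  let f : G'.ConnectedComponent → Option G.ConnectedComponent := fun C =>
    if C = G'.connectedComponentMk u then none
    else some (C.map (Hom.ofLE (deleteEdges_le _)))
  refine Nat.card_le_card_of_injective f ?_
  intro C D
  induction C using ConnectedComponent.ind with | _ x
  induction D using ConnectedComponent.ind with | _ y
  intro h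
  simp only [f, ConnectedComponent.eq] at h ⊢
  by_cases hx : G'.Reachable x u <;> by_cases hy : G'.Reachable y u
  · exact hx.trans hy.symm
  · simp [hx, hy] at h
  · simp [hx, hy] at h
  · simp only [hx, hy, if_false, Option.some.injEq] at h
    replace h := ConnectedComponent.eq.1 h
    rcases reachable_deleteEdges_or (u := u) (v := v) h with h | ⟨h1, h2⟩
    · exact h
    · exact (h1.resolve_left hx).trans (h2.resolve_left hy).symm

lemma card_connectedComponent_deleteEdges_of_reachable {u v : V}
    (h : (G.deleteEdges {s(u, v)}).Reachable u v) :
    Nat.card (G.deleteEdges {s(u, v)}).ConnectedComponent ≤ Nat.card G.ConnectedComponent := by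
  refine Nat.card_le_card_of_injective
    (fun C => C.map (Hom.ofLE (deleteEdges_le {s(u, v)}))) ?_
  intro C D
  induction C using ConnectedComponent.ind with | _ x
  induction D using ConnectedComponent.ind with | _ y
  intro hxy
  simp only [ConnectedComponent.map_mk, ConnectedComponent.eq] at hxy ⊢
  rcases reachable_deleteEdges_or (u := u) (v := v) hxy with hxy | ⟨h1, h2⟩
  · exact hxy
  · have h1' := h1.elim id fun h1 => h1.trans h.symm
    have h2' := h2.elim id fun h2 => h2.trans h.symm
    exact h1'.trans h2'.symm

lemma ncard_edgeSet_deleteEdges {u v : V} (h : G.Adj u v) :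
    (G.deleteEdges {s(u, v)}).edgeSet.ncard + 1 = G.edgeSet.ncard := by
  rw [edgeSet_deleteEdges]
  exact Set.ncard_sdiff_singleton_add_one h

lemma cyc_deleteEdges_le {u v : V} (h : G.Adj u v) :
    cyc (G.deleteEdges {s(u, v)}) ≤ cyc G := by
  have h1 := card_connectedComponent_deleteEdges_le (G := G) u v
  have h2 := ncard_edgeSet_deleteEdges h
  unfold cyc
  omega

lemma cyc_deleteEdges_of_reachable {u v : V} (h : G.Adj u v)
    (hr : (G.deleteEdges {s(u, v)}).Reachable u v) :
    cyc (G.deleteEdges {s(u, v)}) + 1 ≤ cyc G := by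
  have h1 := card_connectedComponent_deleteEdges_of_reachable hr
  have h2 := ncard_edgeSet_deleteEdges h
  unfold cyc
  omega

lemma card_adjPairs_univ (G : SimpleGraph V) :
    (adjPairs G univ univ).card = 2 * G.edgeSet.ncard := by
  classical
  have h := G.dart_card_eq_twice_card_edges
  rw [← Set.ncard_coe_finset, coe_edgeFinset] at h
  rw [← h, ← Finset.card_univ]
  refine (Finset.card_bij (fun d _ => d.toProd) (fun d _ => ?_) (fun d _ d' _ hd => ?_)
    fun p hp => ?_).symm
  · simp [mem_adjPairs, d.adj]
  · exact Dart.ext _ _ hd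
  · exact ⟨⟨p, (mem_adjPairs.1 hp).2⟩, mem_univ _, rfl⟩

/-- The cyclomatic number is at least that of a connected graph on `W` with the edges of `G`
inside `W`. -/
lemma card_adjPairs_le_cyc (G : SimpleGraph V) {W : Finset V} (hW : W.Nonempty) :
    ((adjPairs G W W).card : ℤ) + 2 ≤ 2 * cyc G + 2 * W.card := by
  induction hn : G.edgeSet.ncard using Nat.strong_induction_on generalizing G with
  | _ n ih =>
  by_cases h : ∃ x y, G.Adj x y ∧ ¬ (x ∈ W ∧ y ∈ W)
  · obtain ⟨x, y, hxy, hW'⟩ := h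
    have h1 := ncard_edgeSet_deleteEdges hxy
    have h2 := ih _ (by omega) (G.deleteEdges {s(x, y)}) rfl
    have h3 := cyc_deleteEdges_le hxy
    have h4 : adjPairs (G.deleteEdges {s(x, y)}) W W = adjPairs G W W := by
      ext ⟨a, b⟩
      simp only [mem_adjPairs, deleteEdges_adj, Set.mem_singleton_iff, Sym2.eq_iff]
      grind
    rw [h4] at h2
    omega
  · classical
    push Not at h
    have h1 : adjPairs G W W = adjPairs G univ univ := by
      ext ⟨a, b⟩
      simp only [mem_adjPairs, mem_univ, true_and]
      exact ⟨fun h => h.2, fun hab => ⟨h a b hab, hab⟩⟩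
    obtain ⟨w, hw⟩ := hW
    have hr : ∀ x y, x ∉ W → G.Reachable x y → x = y := by
      rintro x y hx ⟨p⟩
      cases p with
      | nil => rfl
      | cons h' _ => exact absurd (h _ _ h').1 hx
    have h2 : Nat.card (Option {x // x ∉ W}) ≤ Nat.card G.ConnectedComponent := by
      refine Nat.card_le_card_of_injective
        (fun o => G.connectedComponentMk (o.elim w Subtype.val)) ?_
      intro a b hab
      rcases a with _ | a <;> rcases b with _ | b <;>
        simp only [Option.elim, ConnectedComponent.eq] at hab
      · rfl
      · exact absurd (hr _ _ b.2 hab.symm) (fun hb => b.2 (hb ▸ hw))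
      · exact absurd (hr _ _ a.2 hab) (fun hb => a.2 (hb ▸ hw))
      · rw [Subtype.ext (hr _ _ a.2 hab)]
    rw [Finite.card_option, Nat.card_eq_fintype_card, Fintype.card_subtype_compl,
      Fintype.card_coe] at h2
    have h3 := Finset.card_le_univ W
    rw [h1, card_adjPairs_univ]
    unfold cyc
    rw [Nat.card_eq_fintype_card (α := V)]
    push_cast
    omega

lemma cyc_nonneg [Nonempty V] (G : SimpleGraph V) : 0 ≤ cyc G := by
  classical
  have h := card_adjPairs_le_cyc G (Finset.singleton_nonempty (Classical.arbitrary V))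
  rw [Finset.card_singleton] at h
  omega

/-- If every edge lies on a cycle and `W` already carries the whole cyclomatic number, then all
edges lie inside `W`. -/
lemma mem_of_cyc_le {W : Finset V} (hW : W.Nonempty)
    (hb : ∀ x y, G.Adj x y → (G.deleteEdges {s(x, y)}).Reachable x y)
    (hc : 2 * cyc G + 2 * W.card ≤ (adjPairs G W W).card + 2) {x y : V} (hxy : G.Adj x y) :
    x ∈ W := by
  by_contra hx
  have h1 := card_adjPairs_le_cyc (G.deleteEdges {s(x, y)}) hW
  have h2 := cyc_deleteEdges_of_reachable hxy (hb x y hxy)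
  have h4 : adjPairs (G.deleteEdges {s(x, y)}) W W = adjPairs G W W := by
    ext ⟨a, b⟩
    simp only [mem_adjPairs, deleteEdges_adj, Set.mem_singleton_iff, Sym2.eq_iff]
    grind
  rw [h4] at h1
  omega

end Cyclomatic

section Spanning

variable {V : Type*} {G : SimpleGraph V} {K W : Finset V}

lemma adjPairs_mono {A B A' B' : Finset V} (hA : A ⊆ A') (hB : B ⊆ B') :
    adjPairs G A B ⊆ adjPairs G A' B' := by
  intro p hp
  rw [mem_adjPairs] at hp ⊢
  exact ⟨⟨hA hp.1.1, hB hp.1.2⟩, hp.2⟩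

lemma card_adjPairs_comm (A B : Finset V) : (adjPairs G A B).card = (adjPairs G B A).card := by
  refine Finset.card_bij (fun p _ => p.swap) ?_ (fun p _ q _ h => Prod.swap_injective h) ?_
  · intro p hp
    rw [mem_adjPairs] at hp ⊢
    exact ⟨hp.1.symm, hp.2.symm⟩
  · intro p hp
    rw [mem_adjPairs] at hp
    exact ⟨p.swap, mem_adjPairs.2 ⟨hp.1.symm, hp.2.symm⟩, p.swap_swap⟩

variable [DecidableEq V]

lemma exists_parent (hK : (G.induce (K : Set V)).Connected) {w : V} (hw : w ∈ K) :
    ∃ (p : V → V) (d : V → ℕ), ∀ x ∈ K, x ≠ w → p x ∈ K ∧ G.Adj x (p x) ∧ d (p x) < d x := by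
  classical
  let d : V → ℕ := fun x => if hx : x ∈ K then (G.induce (K : Set V)).dist ⟨x, hx⟩ ⟨w, hw⟩ else 0
  have key : ∀ x, ∃ y, x ∈ K → x ≠ w → y ∈ K ∧ G.Adj x y ∧ d y < d x := by
    intro x
    by_cases hx : x ∈ K ∧ x ≠ w
    · obtain ⟨q, hq⟩ := hK.exists_walk_length_eq_dist ⟨x, hx.1⟩ ⟨w, hw⟩
      cases q with
      | nil => exact absurd rfl hx.2
      | @cons _ y _ h q =>
        refine ⟨y, fun _ _ => ⟨y.2, h, ?_⟩⟩
        have h1 := dist_le q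
        have h2 : y.1 ∈ K := y.2
        have h3 : d x = _ := dif_pos hx.1
        have h4 : d y = _ := dif_pos h2
        rw [Walk.length_cons] at hq
        rw [h3, h4, ← hq]
        exact Nat.lt_succ_of_le h1
    · exact ⟨x, fun h1 h2 => absurd ⟨h1, h2⟩ hx⟩
  choose p hp using key
  exact ⟨p, d, hp⟩

/-- Every vertex of `K` outside `W` is charged to the edge leading to its parent. -/
lemma exists_parent_pairs (hK : (G.induce (K : Set V)).Connected) (hW : W.Nonempty) (hWK : W ⊆ K) :
    ∃ (p : V → V) (d : V → ℕ), (∀ x ∈ K \ W, d (p x) < d x) ∧ ∃ T : Finset (V × V),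
      T.card = 2 * (K \ W).card ∧ T ⊆ adjPairs G K K \ adjPairs G W W ∧
      ∀ q ∈ T, q.1 ∈ K \ W ∧ q.2 = p q.1 ∨ q.2 ∈ K \ W ∧ q.1 = p q.2 := by
  obtain ⟨w, hw⟩ := hW
  obtain ⟨p, d, h⟩ := exists_parent hK (hWK hw)
  have h' : ∀ x ∈ K \ W, p x ∈ K ∧ G.Adj x (p x) ∧ d (p x) < d x := fun x hx =>
    h x (Finset.mem_sdiff.1 hx).1 (fun hxw => (Finset.mem_sdiff.1 hx).2 (hxw ▸ hw))
  refine ⟨p, d, fun x hx => (h' x hx).2.2,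
    (K \ W).image (fun x => (x, p x)) ∪ (K \ W).image (fun x => (p x, x)), ?_, ?_, ?_⟩
  · rw [card_union_of_disjoint, card_image_of_injective, card_image_of_injective, two_mul]
    · intro x y hxy
      exact (Prod.ext_iff.1 hxy).2
    · intro x y hxy
      exact (Prod.ext_iff.1 hxy).1
    · rw [Finset.disjoint_left]
      rintro q hq hq'
      obtain ⟨x, hx, rfl⟩ := mem_image.1 hq
      obtain ⟨y, hy, hxy⟩ := mem_image.1 hq'
      have h1 := (h' x hx).2.2
      have h2 := (h' y hy).2.2
      simp only [Prod.mk.injEq] at hxy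
      rw [hxy.1, hxy.2] at h2
      omega
  · intro q hq
    rcases mem_union.1 hq with hq | hq
    · obtain ⟨x, hx, rfl⟩ := mem_image.1 hq
      have := h' x hx
      simp only [Finset.mem_sdiff, mem_adjPairs] at hx ⊢
      tauto
    · obtain ⟨x, hx, rfl⟩ := mem_image.1 hq
      have := h' x hx
      have := this.2.1.symm
      simp only [Finset.mem_sdiff, mem_adjPairs] at hx ⊢
      tauto
  · intro q hq
    rcases mem_union.1 hq with hq | hq
    · obtain ⟨x, hx, rfl⟩ := mem_image.1 hq
      exact Or.inl ⟨hx, rfl⟩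
    · obtain ⟨x, hx, rfl⟩ := mem_image.1 hq
      exact Or.inr ⟨hx, rfl⟩

lemma card_adjPairs_ge (hK : (G.induce (K : Set V)).Connected) (hW : W.Nonempty) (hWK : W ⊆ K) :
    2 * (K \ W).card + (adjPairs G W W).card ≤ (adjPairs G K K).card := by
  obtain ⟨p, d, -, T, hT, hTs, -⟩ := exists_parent_pairs hK hW hWK
  have h1 := card_le_card hTs
  rw [card_sdiff_of_subset (adjPairs_mono hWK hWK)] at h1
  have h2 := card_le_card (adjPairs_mono (G := G) hWK hWK)
  omega

/-- Contracting `W` turns the graph induced on `K` into a tree; `f` is the depth. -/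
lemma exists_parent_of_card_le (hK : (G.induce (K : Set V)).Connected) (hW : W.Nonempty)
    (hWK : W ⊆ K) (hc : (adjPairs G K K).card ≤ 2 * (K \ W).card + (adjPairs G W W).card) :
    ∃ (p : V → V) (d : V → ℕ), (∀ x ∈ K \ W, d (p x) < d x) ∧
      ∀ x ∈ K, ∀ y ∈ K, G.Adj x y → (x ∈ W ∧ y ∈ W) ∨ (x ∉ W ∧ y = p x) ∨ (y ∉ W ∧ x = p y) := by
  obtain ⟨p, d, hd, T, hT, hTs, hTp⟩ := exists_parent_pairs hK hW hWK
  refine ⟨p, d, hd, fun x hx y hy hxy => ?_⟩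
  have hTeq := eq_of_subset_of_card_le hTs (by
    rw [card_sdiff_of_subset (adjPairs_mono hWK hWK)]
    omega)
  by_cases hxyW : x ∈ W ∧ y ∈ W
  · exact Or.inl hxyW
  · have hmem : (x, y) ∈ T := by
      rw [hTeq, Finset.mem_sdiff, mem_adjPairs, mem_adjPairs]
      exact ⟨⟨⟨hx, hy⟩, hxy⟩, fun h => hxyW h.1⟩
    rcases hTp _ hmem with ⟨h1, h2⟩ | ⟨h1, h2⟩
    · exact Or.inr (Or.inl ⟨(Finset.mem_sdiff.1 h1).2, h2⟩)
    · exact Or.inr (Or.inr ⟨(Finset.mem_sdiff.1 h1).2, h2⟩)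

/-- A vertex set `W` of a graph on `K` such that contracting `W` destroys all short cycles. -/
structure ShortCyclesWithin (G : SimpleGraph V) (K W : Finset V) : Prop where
  eq_of_adj : ∀ x ∈ K, x ∉ W → ∀ y ∈ W, ∀ z ∈ W, G.Adj x y → G.Adj x z → y = z
  triangle : ∀ x ∈ K, ∀ y ∈ K, ∀ z ∈ K, G.Adj x y → G.Adj y z → G.Adj z x → x ∈ W
  square : ∀ x ∈ K, ∀ y ∈ K, ∀ z ∈ K, ∀ t ∈ K, G.Adj x y → G.Adj y z → G.Adj z t → G.Adj t x →
    x ≠ z → y ≠ t → x ∈ W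

lemma shortCyclesWithin_of_card_le (hK : (G.induce (K : Set V)).Connected) (hW : W.Nonempty)
    (hWK : W ⊆ K) (hc : (adjPairs G K K).card ≤ 2 * (K \ W).card + (adjPairs G W W).card) :
    ShortCyclesWithin G K W := by
  obtain ⟨p, d, hd, hp⟩ := exists_parent_of_card_le hK hW hWK hc
  have hd' : ∀ x ∈ K, x ∉ W → d (p x) < d x := fun x h1 h2 => hd x (Finset.mem_sdiff.2 ⟨h1, h2⟩)
  refine ⟨?_, ?_, ?_⟩
  · intro x hx hxW y hy z hz hxy hxz
    have h1 := hp x hx y (hWK hy) hxy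
    have h2 := hp x hx z (hWK hz) hxz
    grind
  · intro x hx y hy z hz hxy hyz hzx
    have h1 := hp x hx y hy hxy
    have h2 := hp y hy z hz hyz
    have h3 := hp z hz x hx hzx
    have h4 := hd' x hx
    have h5 := hd' y hy
    have h6 := hd' z hz
    have := hxy.ne
    have := hyz.ne
    have := hzx.ne
    by_contra hxW
    grind
  · intro x hx y hy z hz t ht hxy hyz hzt htx hxz hyt
    have h1 := hp x hx y hy hxy
    have h2 := hp y hy z hz hyz
    have h3 := hp z hz t ht hzt
    have h8 := hp t ht x hx htx
    have h4 := hd' x hx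
    have h5 := hd' y hy
    have h6 := hd' z hz
    have h7 := hd' t ht
    have := hxy.ne
    have := hyz.ne
    have := hzt.ne
    have := htx.ne
    by_contra hxW
    grind

end Spanning

section Score

variable {V : Type*} [Fintype V]

open Classical in
/-- The common neighbours of two vertices. -/
noncomputable def commonNbrs (G : SimpleGraph V) (x y : V) : Finset V :=
  {z | G.Adj x z ∧ G.Adj y z}

open Classical in
/-- The neighbours of `x` other than `y`. -/
noncomputable def otherNbrs (G : SimpleGraph V) (x y : V) : Finset V :=
  {z | G.Adj x z ∧ z ≠ y}

open Classical in
/-- The number of 2-paths between `x` and `y` that form a bad pair. -/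
noncomputable def badPaths (G : SimpleGraph V) (x y : V) : ℕ :=
  if G.Adj x y then (commonNbrs G x y).card else (commonNbrs G x y).card - 1

open Classical in
/-- The contribution of the pair `x`, `y` to `4 * n₁(G)`. -/
noncomputable def pairScore (G : SimpleGraph V) (x y : V) : ℤ :=
  if x = y then 0 else
    (commonNbrs G x y).card * ((commonNbrs G x y).card - 1) + 4 * badPaths G x y

/-- Four times the number of bad pairs of `G`, see `four_mul_n1`. -/
noncomputable def score (G : SimpleGraph V) : ℤ := ∑ x, ∑ y, pairScore G x y

open Classical in
/-- The increase of the contribution of the pair `u`, `w` when the edge `uv` is added. -/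
noncomputable def pairGain (G : SimpleGraph V) (u v w : V) : ℤ :=
  if w ∈ otherNbrs G v u then
    2 * ({x ∈ otherNbrs G u v | G.Adj w x} : Finset V).card +
      4 * (if w ∈ otherNbrs G u v ∨ ∃ x ∈ otherNbrs G u v, G.Adj w x then 1 else 0)
  else 0

open Classical in
/-- Half of the increase of the score when the edge `uv` is added. -/
noncomputable def edgeGain (G : SimpleGraph V) (u v : V) : ℤ :=
  ∑ w, pairGain G u v w + ∑ w, pairGain G v u w + 4 * (if (commonNbrs G u v).Nonempty then 1 else 0)

variable {G : SimpleGraph V} {u v w x y z : V}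

@[simp]
lemma mem_commonNbrs : z ∈ commonNbrs G x y ↔ G.Adj x z ∧ G.Adj y z := by
  simp [commonNbrs]

@[simp]
lemma mem_otherNbrs : z ∈ otherNbrs G x y ↔ G.Adj x z ∧ z ≠ y := by
  simp [otherNbrs]

lemma commonNbrs_comm (x y : V) : commonNbrs G x y = commonNbrs G y x := by
  ext z
  simp [and_comm]

lemma badPaths_of_adj (h : G.Adj x y) : badPaths G x y = (commonNbrs G x y).card := if_pos h

lemma badPaths_of_not_adj (h : ¬ G.Adj x y) : badPaths G x y = (commonNbrs G x y).card - 1 :=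
  if_neg h

lemma pairScore_of_ne (h : x ≠ y) : pairScore G x y =
    (commonNbrs G x y).card * ((commonNbrs G x y).card - 1) + 4 * badPaths G x y := if_neg h

@[simp]
lemma pairScore_self : pairScore G x x = 0 := if_pos rfl

lemma pairScore_congr {V' : Type*} [Fintype V'] {G' : SimpleGraph V'} {x' y' : V'}
    (h : (commonNbrs G x y).card = (commonNbrs G' x' y').card) (ha : G.Adj x y ↔ G'.Adj x' y')
    (he : x = y ↔ x' = y') : pairScore G x y = pairScore G' x' y' := by
  by_cases hxy : x = y
  · obtain rfl := hxy
    obtain rfl := he.1 rfl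
    simp
  · rw [pairScore_of_ne hxy, pairScore_of_ne (he.not.1 hxy), h]
    by_cases hadj : G.Adj x y
    · rw [badPaths_of_adj hadj, badPaths_of_adj (ha.1 hadj), h]
    · rw [badPaths_of_not_adj hadj, badPaths_of_not_adj (ha.not.1 hadj), h]

lemma pairScore_comm (x y : V) : pairScore G x y = pairScore G y x :=
  pairScore_congr (by rw [commonNbrs_comm]) (G.adj_comm x y) eq_comm

lemma pairScore_deleteEdges_of_ne (hx : x ≠ u ∧ x ≠ v) (hy : y ≠ u ∧ y ≠ v) :
    pairScore (G.deleteEdges {s(u, v)}) x y = pairScore G x y := by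
  have h1 : commonNbrs (G.deleteEdges {s(u, v)}) x y = commonNbrs G x y := by
    ext z
    simp only [mem_commonNbrs, deleteEdges_adj, Set.mem_singleton_iff, Sym2.eq_iff]
    tauto
  have h2 : (G.deleteEdges {s(u, v)}).Adj x y ↔ G.Adj x y := by
    simp only [deleteEdges_adj, Set.mem_singleton_iff, Sym2.eq_iff]
    tauto
  exact pairScore_congr (by rw [h1]) h2 Iff.rfl

lemma pairScore_deleteEdges_self (huv : G.Adj u v) :
    pairScore G u v = pairScore (G.deleteEdges {s(u, v)}) u v +
      4 * (if (commonNbrs G u v).Nonempty then 1 else 0) := by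
  have h1 : commonNbrs (G.deleteEdges {s(u, v)}) u v = commonNbrs G u v := by
    ext z
    simp only [mem_commonNbrs, deleteEdges_adj, Set.mem_singleton_iff, Sym2.eq_iff]
    constructor
    · tauto
    · rintro ⟨h1, h2⟩
      have := h1.ne
      have := h2.ne
      grind
  have h2 : ¬ (G.deleteEdges {s(u, v)}).Adj u v := by simp
  simp only [pairScore, badPaths, h1, h2, huv, huv.ne, if_true, if_false, ← Finset.card_pos]
  split_ifs with h
  · push_cast [Nat.cast_sub h]
    ring
  · rw [Nat.le_zero.1 (not_lt.1 h)]
    simp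

lemma pairScore_deleteEdges_left (huv : G.Adj u v) (hu : w ≠ u) (hv : w ≠ v) :
    pairScore G u w = pairScore (G.deleteEdges {s(u, v)}) u w + pairGain G u v w := by
  classical
  have h1 : commonNbrs (G.deleteEdges {s(u, v)}) u w = {x ∈ otherNbrs G u v | G.Adj w x} := by
    ext z
    simp only [mem_commonNbrs, mem_otherNbrs, Finset.mem_filter, deleteEdges_adj,
      Set.mem_singleton_iff, Sym2.eq_iff]
    have := huv.ne
    grind
  have h2 : (G.deleteEdges {s(u, v)}).Adj u w ↔ G.Adj u w := by
    simp only [deleteEdges_adj, Set.mem_singleton_iff, Sym2.eq_iff]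
    grind
  have h3 : w ∈ otherNbrs G u v ↔ G.Adj u w := by simp [hv]
  have h3' : w ∈ otherNbrs G v u ↔ G.Adj v w := by simp [hu]
  have h6 : (∃ x ∈ otherNbrs G u v, G.Adj w x) ↔
      0 < ({x ∈ otherNbrs G u v | G.Adj w x} : Finset V).card := by
    rw [Finset.card_pos, Finset.filter_nonempty_iff]
  have h7 : pairGain G u v w = if G.Adj v w then
      2 * (({x ∈ otherNbrs G u v | G.Adj w x} : Finset V).card : ℤ) +
      4 * (if G.Adj u w ∨ 0 < ({x ∈ otherNbrs G u v | G.Adj w x} : Finset V).card then 1 else 0)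
      else 0 := by
    simp only [pairGain, h3, h3', h6]
  rw [h7, pairScore_of_ne hu.symm, pairScore_of_ne hu.symm, h1]
  generalize hS : ({x ∈ otherNbrs G u v | G.Adj w x} : Finset V) = S
  rw [hS] at h1
  by_cases h4 : G.Adj v w
  · have h5 : commonNbrs G u w = insert v S := by
      subst hS
      ext z
      simp only [mem_commonNbrs, mem_otherNbrs, Finset.mem_filter, Finset.mem_insert]
      have := h4.symm
      grind
    have h8 : v ∉ S := by
      subst hS
      simp
    rw [h5, card_insert_of_notMem h8]
    simp only [h4, if_true]
    by_cases h9 : G.Adj u w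
    · rw [badPaths_of_adj h9, badPaths_of_adj (h2.2 h9), h1, h5, card_insert_of_notMem h8]
      simp only [h9, if_true, true_or]
      push_cast
      ring
    · rw [badPaths_of_not_adj h9, badPaths_of_not_adj (h2.not.2 h9), h1, h5,
        card_insert_of_notMem h8]
      simp only [h9, false_or]
      rcases Nat.eq_zero_or_pos S.card with h10 | h10
      · simp [h10]
      · simp only [h10, if_true]
        push_cast [Nat.cast_sub h10]
        ring
  · have h5 : commonNbrs G u w = S := by
      subst hS
      ext z
      simp only [mem_commonNbrs, mem_otherNbrs, Finset.mem_filter]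
      have : ¬ G.Adj w v := fun h => h4 h.symm
      grind
    have h9 : badPaths (G.deleteEdges {s(u, v)}) u w = badPaths G u w := by
      by_cases h : G.Adj u w
      · rw [badPaths_of_adj h, badPaths_of_adj (h2.2 h), h1, h5]
      · rw [badPaths_of_not_adj h, badPaths_of_not_adj (h2.not.2 h), h1, h5]
    rw [h9, h5, if_neg h4, add_zero]

lemma pairGain_eq_zero (h : w = u ∨ w = v) : pairGain G u v w = 0 := by
  have : w ∉ otherNbrs G v u := by
    rcases h with rfl | rfl <;> simp
  simp [pairGain, this]

lemma score_deleteEdges (huv : G.Adj u v) :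
    score G = score (G.deleteEdges {s(u, v)}) + 2 * edgeGain G u v := by
  classical
  have hs : s(v, u) = s(u, v) := Sym2.eq_swap
  set c : ℤ := 4 * (if (commonNbrs G u v).Nonempty then 1 else 0) with hc
  have key : ∀ x y, pairScore G x y = pairScore (G.deleteEdges {s(u, v)}) x y +
      ((if x = u then pairGain G u v y else 0) + (if y = u then pairGain G u v x else 0) +
       (if x = v then pairGain G v u y else 0) + (if y = v then pairGain G v u x else 0) +
       ((if x = u then if y = v then c else 0 else 0) +
        (if x = v then if y = u then c else 0 else 0))) := by
    intro x y
    have hne := huv.ne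
    have hne' := hne.symm
    have g1 : ∀ w, w = u ∨ w = v → pairGain G u v w = 0 := fun w => pairGain_eq_zero
    have g2 : ∀ w, w = v ∨ w = u → pairGain G v u w = 0 := fun w => pairGain_eq_zero
    have e1 : ∀ w, w ≠ u → w ≠ v → pairScore G u w =
      pairScore (G.deleteEdges {s(u, v)}) u w + pairGain G u v w :=
        fun w => pairScore_deleteEdges_left huv
    have e2 : ∀ w, w ≠ u → w ≠ v → pairScore G v w =
      pairScore (G.deleteEdges {s(u, v)}) v w + pairGain G v u w := fun w h1 h2 => by
        rw [← hs]
        exact pairScore_deleteEdges_left huv.symm h2 h1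
    have e3 := pairScore_deleteEdges_self huv
    by_cases hx : x = u
    · subst hx
      by_cases hy : y = v
      · subst hy
        rw [e3, g1 y (Or.inr rfl), g2 x (Or.inr rfl)]
        simp [hne, hne', hc]
      · by_cases hy' : y = x
        · subst hy'
          simp [hne, g1]
        · simp [e1 y hy' hy, hy, hy', hne]
    · by_cases hx' : x = v
      · subst hx'
        by_cases hy : y = u
        · subst hy
          rw [pairScore_comm, pairScore_comm (G := G.deleteEdges _) x y, e3, g1 x (Or.inr rfl),
            g2 y (Or.inr rfl)]
          simp [hne, hne', hc]
        · by_cases hy' : y = x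
          · subst hy'
            simp [hx, g2]
          · simp [e2 y hy hy', hy, hy', hx]
      · by_cases hy : y = u
        · subst hy
          rw [pairScore_comm, pairScore_comm (G := G.deleteEdges _) x y, e1 x hx hx']
          simp [hx, hx', hne]
        · by_cases hy' : y = v
          · subst hy'
            rw [pairScore_comm, pairScore_comm (G := G.deleteEdges _) x y, e2 x hx hx']
            simp [hx, hx', hne']
          · rw [pairScore_deleteEdges_of_ne ⟨hx, hx'⟩ ⟨hy, hy'⟩]
            simp [hx, hx', hy, hy']
  unfold score
  simp_rw [key, Finset.sum_add_distrib]
  have t1 : ∀ (a : V) (f : V → ℤ), ∑ x, ∑ y, (if x = a then f y else 0) = ∑ y, f y := by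
    intro a f
    rw [Finset.sum_comm]
    simp
  have t3 : ∀ a b : V, ∑ x, ∑ y, (if x = a then if y = b then c else 0 else 0) = c := by
    intro a b
    rw [Finset.sum_comm]
    simp
  rw [t1, t1, t3, t3]
  simp only [Finset.sum_ite_eq', Finset.mem_univ, if_true]
  unfold edgeGain
  rw [← hc]
  ring

end Score

section Link

variable {V : Type*} {G : SimpleGraph V}

lemma connected_induce_insert [DecidableEq V] {K : Finset V} {a w : V}
    (hK : (G.induce (K : Set V)).Connected) (ha : a ∈ K) (h : G.Adj a w) :
    (G.induce ((insert w K : Finset V) : Set V)).Connected := by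
  have := induce_union_connected hK.preconnected (induce_pair_connected_of_adj h).preconnected
    ⟨a, ha, by simp⟩
  have hs : ((insert w K : Finset V) : Set V) = (K : Set V) ∪ {a, w} := by
    ext x
    simp only [coe_insert, Set.mem_insert_iff, mem_coe, Set.mem_union, Set.mem_singleton_iff]
    grind
  rwa [hs]

lemma connected_induce_singleton (w : V) :
    (G.induce (({w} : Finset V) : Set V)).Connected := by
  have : Subsingleton (({w} : Finset V) : Set V) := by simp
  have : Nonempty (({w} : Finset V) : Set V) := by simp
  exact ⟨.of_subsingleton⟩

lemma card_adjPairs_insert_ge [DecidableEq V] {K T : Finset V} {u : V} (hu : u ∉ K) (hT : T ⊆ K)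
    (h : ∀ x ∈ T, G.Adj u x) :
    (adjPairs G K K).card + 2 * T.card ≤ (adjPairs G (insert u K) (insert u K)).card := by
  have h1 : Disjoint (T.image fun x => (u, x)) (T.image fun x => (x, u)) := by
    rw [Finset.disjoint_left]
    simp only [Finset.mem_image]
    rintro _ ⟨x, hx, rfl⟩ ⟨y, hy, h⟩
    simp only [Prod.mk.injEq] at h
    exact hu (h.1 ▸ hT hy)
  have h2 : Disjoint (adjPairs G K K) ((T.image fun x => (u, x)) ∪ T.image fun x => (x, u)) := by
    rw [Finset.disjoint_left]
    simp only [Finset.mem_image, Finset.mem_union, mem_adjPairs]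
    rintro p hp (⟨x, hx, rfl⟩ | ⟨x, hx, rfl⟩)
    · exact hu hp.1.1
    · exact hu hp.1.2
  have h3 : adjPairs G K K ∪ ((T.image fun x => (u, x)) ∪ T.image fun x => (x, u)) ⊆
      adjPairs G (insert u K) (insert u K) := by
    intro p hp
    simp only [Finset.mem_image, Finset.mem_union, mem_adjPairs] at hp
    rw [mem_adjPairs]
    rcases hp with hp | ⟨x, hx, rfl⟩ | ⟨x, hx, rfl⟩
    · simp [hp.1.1, hp.1.2, hp.2]
    · simp [hT hx, h x hx]
    · simp [hT hx, (h x hx).symm]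
  have h4 := card_le_card h3
  rw [card_union_of_disjoint h2, card_union_of_disjoint h1,
    card_image_of_injective _ (Prod.mk_right_injective u),
    card_image_of_injective _ (Prod.mk_left_injective u)] at h4
  omega

/-- `K` is a connected vertex set linking the two ends of the edge `uv`. -/
structure Link (G : SimpleGraph V) (u v : V) (K : Finset V) : Prop where
  adj : G.Adj u v
  notMem_left : u ∉ K
  notMem_right : v ∉ K
  connected : (G.induce (K : Set V)).Connected
  exists_left : ∃ a ∈ K, G.Adj u a
  exists_right : ∃ b ∈ K, G.Adj v b

/-- A link with the largest possible number of vertices. -/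
structure MaxLink (G : SimpleGraph V) (u v : V) (K : Finset V) : Prop extends Link G u v K where
  le : ∀ u' v' K', Link G u' v' K' → K'.card ≤ K.card

variable {u v w x : V} {K : Finset V}

lemma Link.symm (h : Link G u v K) : Link G v u K :=
  ⟨h.adj.symm, h.notMem_right, h.notMem_left, h.connected, h.exists_right, h.exists_left⟩

lemma MaxLink.symm (h : MaxLink G u v K) : MaxLink G v u K := ⟨h.toLink.symm, h.le⟩

lemma MaxLink.mem_of_adj (h : MaxLink G u v K) (hx : x ∈ K) (hxw : G.Adj x w) (hu : w ≠ u)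
    (hv : w ≠ v) : w ∈ K := by
  classical
  by_contra hw
  obtain ⟨a, ha, hua⟩ := h.exists_left
  obtain ⟨b, hb, hvb⟩ := h.exists_right
  have := h.le u v (insert w K) ⟨h.adj, by simp [hu.symm, h.notMem_left],
    by simp [hv.symm, h.notMem_right], connected_induce_insert h.connected hx hxw,
    ⟨a, by simp [ha], hua⟩, ⟨b, by simp [hb], hvb⟩⟩
  rw [card_insert_of_notMem hw] at this
  omega

/-- A neighbour `w` of `v` that lies on a triangle or square through `uv` lies in `K`. -/
lemma MaxLink.mem_of_adj_right (h : MaxLink G u v K) (hvw : G.Adj v w) (hwu : w ≠ u)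
    (hw : G.Adj w u ∨ ∃ x, G.Adj u x ∧ x ≠ v ∧ G.Adj w x) : w ∈ K := by
  classical
  by_contra hwK
  obtain ⟨a, ha, hua⟩ := h.exists_left
  have hc := connected_induce_insert h.connected ha hua.symm
  have hcard := card_insert_of_notMem h.notMem_left
  by_cases hx : G.Adj w u
  · have := h.le v w (insert u K) ⟨hvw, by simp [h.adj.ne.symm, h.notMem_right],
      by simp [hwK, hwu], hc, ⟨u, by simp, h.adj.symm⟩, ⟨u, by simp, hx⟩⟩
    omega
  · obtain ⟨x, hux, hxv, hwx⟩ := hw.resolve_left hx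
    have := h.le v w (insert x (insert u K)) ⟨hvw,
      by simp [h.adj.ne.symm, h.notMem_right, hxv.symm],
      by simp [hwK, hwu, hwx.ne], connected_induce_insert hc (by simp) hux,
      ⟨u, by simp, h.adj.symm⟩, ⟨x, by simp, hwx⟩⟩
    have := card_le_card (subset_insert x (insert u K))
    omega

lemma exists_link [Fintype V] (huv : G.Adj u v) (h : edgeGain G u v ≠ 0) : ∃ K, Link G u v K := by
  classical
  have key : ∀ u v : V, G.Adj u v → ∀ w, pairGain G u v w ≠ 0 → ∃ K, Link G u v K := by
    intro u v huv w hw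
    unfold pairGain at hw
    split_ifs at hw with h1 h2
    · rw [mem_otherNbrs] at h1
      by_cases h3 : G.Adj u w
      · exact ⟨{w}, huv, by simp [h3.ne], by simp [h1.1.ne], connected_induce_singleton w,
          ⟨w, by simp, h3⟩, ⟨w, by simp, h1.1⟩⟩
      · obtain ⟨x, hx, hwx⟩ := h2.resolve_left (fun h => h3 (mem_otherNbrs.1 h).1)
        rw [mem_otherNbrs] at hx
        exact ⟨insert x {w}, huv, by simp [hx.1.ne, h1.2.symm], by simp [hx.2.symm, h1.1.ne],
          connected_induce_insert (connected_induce_singleton w) (by simp) hwx,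
          ⟨x, by simp, hx.1⟩, ⟨w, by simp, h1.1⟩⟩
    · exfalso
      apply hw
      rw [Finset.card_eq_zero.2]
      · simp
      · rw [Finset.filter_eq_empty_iff]
        exact fun x hx hx' => h2 (Or.inr ⟨x, hx, hx'⟩)
    · exact absurd rfl hw
  by_contra hcon
  have hcon' : ¬ ∃ K, Link G v u K := fun ⟨K, hK⟩ => hcon ⟨K, hK.symm⟩
  have h1 : ∀ w, pairGain G u v w = 0 := fun w => by
    by_contra hw
    exact hcon (key u v huv w hw)
  have h2 : ∀ w, pairGain G v u w = 0 := fun w => by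
    by_contra hw
    exact hcon' (key v u huv.symm w hw)
  apply h
  unfold edgeGain
  simp only [h1, h2]
  rw [if_neg]
  · simp
  · rintro ⟨z, hz⟩
    rw [mem_commonNbrs] at hz
    have := h1 z
    unfold pairGain at this
    rw [if_pos (mem_otherNbrs.2 ⟨hz.2, hz.1.ne.symm⟩),
      if_pos (Or.inl (mem_otherNbrs.2 ⟨hz.1, hz.2.ne.symm⟩))] at this
    omega

lemma Link.reachable (h : Link G u v K) : (G.deleteEdges {s(u, v)}).Reachable u v := by
  obtain ⟨a, ha, hua⟩ := h.exists_left
  obtain ⟨b, hb, hvb⟩ := h.exists_right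
  have hab := h.connected.preconnected ⟨a, ha⟩ ⟨b, hb⟩
  let f : G.induce (K : Set V) →g G.deleteEdges {s(u, v)} :=
    ⟨Subtype.val, fun {x y} hxy => by
      rw [deleteEdges_adj]
      refine ⟨hxy, fun hs => ?_⟩
      have hu : u ∈ s(x.1, y.1) := by
        rw [Set.mem_singleton_iff.1 hs]
        simp
      rcases Sym2.mem_iff.1 hu with h1 | h1
      · exact h.notMem_left (h1 ▸ x.2)
      · exact h.notMem_left (h1 ▸ y.2)⟩
  have h1 : (G.deleteEdges {s(u, v)}).Adj u a := by
    rw [deleteEdges_adj]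
    refine ⟨hua, fun hs => ?_⟩
    have := h.notMem_right
    have := h.notMem_left
    simp only [Set.mem_singleton_iff, Sym2.eq_iff] at hs
    grind
  have h2 : (G.deleteEdges {s(u, v)}).Adj b v := by
    rw [deleteEdges_adj]
    refine ⟨hvb.symm, fun hs => ?_⟩
    have := h.notMem_right
    have := h.notMem_left
    simp only [Set.mem_singleton_iff, Sym2.eq_iff] at hs
    grind
  exact h1.reachable.trans ((hab.map f).trans h2.reachable)

lemma exists_maxLink [Fintype V] (h : Link G u v K) : ∃ u v K, MaxLink G u v K := by
  classical
  let S : Set ℕ := {k | ∃ u v K, Link G u v K ∧ K.card = k}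
  have hS : S.Nonempty := ⟨_, u, v, K, h, rfl⟩
  have hb : BddAbove S := by
    refine ⟨Fintype.card V, ?_⟩
    rintro _ ⟨u, v, K, -, rfl⟩
    exact card_le_univ K
  obtain ⟨u, v, K, hK, hc⟩ := Nat.sSup_mem hS hb
  exact ⟨u, v, K, hK, fun u' v' K' h' => hc ▸ le_csSup hb ⟨u', v', K', h', rfl⟩⟩

end Link

section EdgeGain

variable {V : Type*} {G : SimpleGraph V} {u v : V} {K : Finset V}

open Classical in
/-- The neighbours of `u` in `K`. -/
noncomputable def nbrsIn (G : SimpleGraph V) (K : Finset V) (u : V) : Finset V :=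
  {x ∈ K | G.Adj u x}

@[simp]
lemma mem_nbrsIn {x : V} : x ∈ nbrsIn G K u ↔ x ∈ K ∧ G.Adj u x := by
  simp [nbrsIn]

lemma nbrsIn_subset : nbrsIn G K u ⊆ K := fun _ hx => (mem_nbrsIn.1 hx).1

/-- The vertices of `B` that lie in `A` or are adjacent to a vertex of `A`. -/
noncomputable def attached (G : SimpleGraph V) (A B : Finset V) : Finset V :=
  open Classical in {w ∈ B | w ∈ A ∨ ∃ x ∈ A, G.Adj w x}

lemma attached_subset {A B : Finset V} : attached G A B ⊆ B := by
  classical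
  exact Finset.filter_subset _ _

lemma mem_attached {A B : Finset V} {w : V} :
    w ∈ attached G A B ↔ w ∈ B ∧ (w ∈ A ∨ ∃ x ∈ A, G.Adj w x) := by
  simp [attached]

lemma Link.nonempty_nbrsIn (h : Link G u v K) : (nbrsIn G K u).Nonempty := by
  obtain ⟨a, ha, hua⟩ := h.exists_left
  exact ⟨a, mem_nbrsIn.2 ⟨ha, hua⟩⟩

lemma MaxLink.sum_pairGain [Fintype V] (h : MaxLink G u v K) :
    ∑ w, pairGain G u v w = 2 * (adjPairs G (nbrsIn G K u) (nbrsIn G K v)).card +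
      4 * (attached G (nbrsIn G K u) (nbrsIn G K v)).card := by
  classical
  set A := nbrsIn G K u with hA
  set B := nbrsIn G K v with hB
  have hBA : ∀ w ∈ B, pairGain G u v w = 2 * (∑ x ∈ A, if G.Adj w x then 1 else 0) +
      4 * (if w ∈ A ∨ ∃ x ∈ A, G.Adj w x then 1 else 0) := by
    intro w hw
    rw [hB, mem_nbrsIn] at hw
    have hwu : w ≠ u := fun he => h.notMem_left (he ▸ hw.1)
    have hwv : w ≠ v := fun he => h.notMem_right (he ▸ hw.1)
    have h1 : ∀ x, G.Adj w x → (x ∈ otherNbrs G u v ↔ x ∈ A) := by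
      intro x hwx
      rw [hA, mem_nbrsIn, mem_otherNbrs]
      refine ⟨fun hx => ⟨h.mem_of_adj hw.1 hwx hx.1.ne.symm hx.2, hx.1⟩, fun hx => ⟨hx.2, ?_⟩⟩
      exact fun he => h.notMem_right (he ▸ hx.1)
    have h2 : ({x ∈ otherNbrs G u v | G.Adj w x} : Finset V) = {x ∈ A | G.Adj w x} := by
      ext x
      rw [Finset.mem_filter, Finset.mem_filter]
      exact and_congr_left (h1 x)
    have h3 : (w ∈ otherNbrs G u v ∨ ∃ x ∈ otherNbrs G u v, G.Adj w x) ↔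
        (w ∈ A ∨ ∃ x ∈ A, G.Adj w x) := by
      refine or_congr ?_ (exists_congr fun x => and_congr_left (h1 x))
      simp [hA, hw.1, hwv]
    rw [pairGain, if_pos (mem_otherNbrs.2 ⟨hw.2, hwu⟩), h2, Finset.card_filter]
    simp only [h3]
    push_cast
    rfl
  have h0 : ∀ w, w ∉ B → pairGain G u v w = 0 := by
    intro w hw
    unfold pairGain
    split_ifs with h1 h2
    · rw [mem_otherNbrs] at h1
      exfalso
      apply hw
      rw [hB, mem_nbrsIn]
      refine ⟨h.mem_of_adj_right h1.1 h1.2 ?_, h1.1⟩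
      rcases h2 with h2 | ⟨x, hx, hwx⟩
      · exact Or.inl (mem_otherNbrs.1 h2).1.symm
      · exact Or.inr ⟨x, (mem_otherNbrs.1 hx).1, (mem_otherNbrs.1 hx).2, hwx⟩
    · rw [Finset.card_eq_zero.2]
      · simp
      · rw [Finset.filter_eq_empty_iff]
        exact fun x hx hx' => h2 (Or.inr ⟨x, hx, hx'⟩)
    · rfl
  rw [← Finset.sum_subset (subset_univ B) (fun w _ => h0 w), Finset.sum_congr rfl hBA,
    Finset.sum_add_distrib, ← Finset.mul_sum, ← Finset.mul_sum, card_adjPairs_comm]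
  congr 2
  · rw [adjPairs, Finset.card_filter, Finset.sum_product]
    push_cast
    rfl
  · rw [attached, Finset.card_filter]
    push_cast
    rfl

lemma MaxLink.edgeGain_eq [Fintype V] [DecidableEq V] (h : MaxLink G u v K) :
    edgeGain G u v = 4 * (adjPairs G (nbrsIn G K u) (nbrsIn G K v)).card +
      4 * (attached G (nbrsIn G K u) (nbrsIn G K v)).card +
      4 * (attached G (nbrsIn G K v) (nbrsIn G K u)).card +
      4 * (if (nbrsIn G K u ∩ nbrsIn G K v).Nonempty then 1 else 0) := by
  have h1 : (commonNbrs G u v).Nonempty ↔ (nbrsIn G K u ∩ nbrsIn G K v).Nonempty := by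
    refine exists_congr fun z => ?_
    rw [mem_commonNbrs, Finset.mem_inter, mem_nbrsIn, mem_nbrsIn]
    refine ⟨fun hz => ?_, fun hz => ⟨hz.1.2, hz.2.2⟩⟩
    have := h.mem_of_adj_right hz.2 hz.1.ne.symm (Or.inl hz.1.symm)
    exact ⟨⟨this, hz.1⟩, this, hz.2⟩
  rw [edgeGain, h.sum_pairGain, h.symm.sum_pairGain, card_adjPairs_comm (nbrsIn G K v)]
  simp only [h1]
  ring

section
variable [DecidableEq V] {A B : Finset V}

omit [DecidableEq V] in
@[simp]
lemma adjPairs_empty_left (B : Finset V) : adjPairs G ∅ B = ∅ := by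
  ext p
  simp

lemma adjPairs_union_subset : adjPairs G A B ∪ adjPairs G B A ⊆ adjPairs G (A ∪ B) (A ∪ B) :=
  Finset.union_subset (adjPairs_mono Finset.subset_union_left Finset.subset_union_right)
    (adjPairs_mono Finset.subset_union_right Finset.subset_union_left)

lemma card_adjPairs_union : (adjPairs G A B ∪ adjPairs G B A).card +
    (adjPairs G (A ∩ B) (A ∩ B)).card = 2 * (adjPairs G A B).card := by
  have h : adjPairs G A B ∩ adjPairs G B A = adjPairs G (A ∩ B) (A ∩ B) := by
    ext p
    simp only [Finset.mem_inter, mem_adjPairs]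
    tauto
  rw [← h, Finset.card_union_add_card_inter, card_adjPairs_comm B A]
  omega

lemma card_adjPairs_insert_insert (huv : G.Adj u v) (hu : u ∉ K) (hv : v ∉ K)
    (hA : ∀ x ∈ A, x ∈ K ∧ G.Adj u x) (hB : ∀ x ∈ B, x ∈ K ∧ G.Adj v x) :
    (adjPairs G K K).card + 2 * A.card + 2 * B.card + 2 ≤
      (adjPairs G (insert u (insert v K)) (insert u (insert v K))).card := by
  have h1 := card_adjPairs_insert_ge hv (fun x hx => (hB x hx).1) (fun x hx => (hB x hx).2)
  have hu' : u ∉ insert v K := by simp [huv.ne, hu]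
  have h2 := card_adjPairs_insert_ge (G := G) (T := insert v A) hu'
    (Finset.insert_subset_insert v fun x hx => (hA x hx).1) (by
      intro x hx
      rcases Finset.mem_insert.1 hx with rfl | hx
      · exact huv
      · exact (hA x hx).2)
  rw [card_insert_of_notMem (fun h => hv (hA v h).1)] at h2
  omega

lemma card_insert_insert (huv : u ≠ v) (hu : u ∉ K) (hv : v ∉ K) :
    (insert u (insert v K)).card = K.card + 2 := by
  rw [card_insert_of_notMem (by simp [huv, hu]), card_insert_of_notMem hv]

lemma Link.card_adjPairs_le [Fintype V] (h : Link G u v K) :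
    ((adjPairs G K K).card : ℤ) + 2 * (nbrsIn G K u).card + 2 * (nbrsIn G K v).card ≤
      2 * cyc G + 2 * K.card := by
  have h1 := card_adjPairs_insert_insert h.adj h.notMem_left h.notMem_right
    (fun x hx => mem_nbrsIn.1 hx) (fun x hx => mem_nbrsIn.1 hx)
  have h2 := card_adjPairs_le_cyc G (W := insert u (insert v K)) (Finset.insert_nonempty _ _)
  rw [card_insert_insert h.adj.ne h.notMem_left h.notMem_right] at h2
  push_cast at h2
  omega

end

end EdgeGain

section TightEdge

variable {V : Type*} [DecidableEq V] {G : SimpleGraph V} {u v : V} {K : Finset V}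

lemma Link.card_ge_union (h : Link G u v K) :
    2 * (K.card - (nbrsIn G K u ∪ nbrsIn G K v).card : ℤ) +
      (adjPairs G (nbrsIn G K u ∪ nbrsIn G K v) (nbrsIn G K u ∪ nbrsIn G K v)).card ≤
      (adjPairs G K K).card := by
  have hW : nbrsIn G K u ∪ nbrsIn G K v ⊆ K := Finset.union_subset nbrsIn_subset nbrsIn_subset
  have h1 := card_adjPairs_ge h.connected h.nonempty_nbrsIn.inl hW
  have h2 := Finset.card_sdiff_add_card_eq_card hW
  omega

lemma Link.card_ge_inter (h : Link G u v K) (hZ : (nbrsIn G K u ∩ nbrsIn G K v).Nonempty) :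
    2 * (K.card - (nbrsIn G K u ∩ nbrsIn G K v).card : ℤ) +
      (adjPairs G (nbrsIn G K u ∩ nbrsIn G K v) (nbrsIn G K u ∩ nbrsIn G K v)).card ≤
      (adjPairs G K K).card := by
  have hW : nbrsIn G K u ∩ nbrsIn G K v ⊆ K := Finset.inter_subset_left.trans nbrsIn_subset
  have h1 := card_adjPairs_ge h.connected hZ hW
  have h2 := Finset.card_sdiff_add_card_eq_card hW
  omega

lemma Link.card_ge_tree (h : Link G u v K) : 2 * K.card ≤ (adjPairs G K K).card + 2 := by
  obtain ⟨a, ha, -⟩ := h.exists_left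
  have hW : {a} ⊆ K := Finset.singleton_subset_iff.2 ha
  have h1 := card_adjPairs_ge h.connected (Finset.singleton_nonempty a) hW
  have h2 := Finset.card_sdiff_add_card_eq_card hW
  rw [Finset.card_singleton] at h2
  omega

lemma MaxLink.edgeGain_le [Fintype V] (h : MaxLink G u v K) : edgeGain G u v ≤ 8 * cyc G + 4 := by
  have h1 := h.card_adjPairs_le
  have h2 := h.card_ge_union
  have h3 := h.card_ge_inter
  have h4 := h.card_ge_tree
  rw [h.edgeGain_eq]
  set A := nbrsIn G K u
  set B := nbrsIn G K v
  have h5 := card_adjPairs_union (G := G) (A := A) (B := B)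
  have h6 := card_le_card (adjPairs_union_subset (G := G) (A := A) (B := B))
  have h7 := Finset.card_union_add_card_inter A B
  have h8 := card_le_card (attached_subset (G := G) (A := A) (B := B))
  have h9 := card_le_card (attached_subset (G := G) (A := B) (B := A))
  split_ifs with hZ
  · have := h3 hZ
    omega
  · rw [Finset.not_nonempty_iff_eq_empty.1 hZ] at h5 h7
    rw [Finset.card_empty] at h7
    rw [adjPairs_empty_left, Finset.card_empty] at h5
    omega

/-- The structure of a graph around an edge `uv` whose removal lowers the score as much as
possible; `A` and `B` are the neighbourhoods of `u` and `v` without these vertices. -/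
structure TightEdge (G : SimpleGraph V) (u v : V) (A B : Finset V) : Prop where
  adj : G.Adj u v
  mem_left : ∀ x, x ∈ A ↔ G.Adj u x ∧ x ≠ v
  mem_right : ∀ x, x ∈ B ↔ G.Adj v x ∧ x ≠ u
  nonempty_left : A.Nonempty
  nonempty_right : B.Nonempty
  exists_left : ∀ x ∈ A, x ∉ B → ∃ y ∈ B, G.Adj x y
  exists_right : ∀ x ∈ B, x ∉ A → ∃ y ∈ A, G.Adj x y
  cover : ∀ x y, G.Adj x y → x = u ∨ x = v ∨ x ∈ A ∪ B
  cross : ∀ x ∈ A ∪ B, ∀ y ∈ A ∪ B, G.Adj x y → (x ∈ A ∧ y ∈ B) ∨ (x ∈ B ∧ y ∈ A)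
  short : ShortCyclesWithin G (A ∪ B) (A ∩ B)
  cyc_eq : (A ∩ B).Nonempty →
    2 * cyc G = (adjPairs G (A ∩ B) (A ∩ B)).card + 2 * (A ∪ B).card
  cyc_eq_of_disjoint : A ∩ B = ∅ → cyc G + 1 = (A ∪ B).card

lemma TightEdge.symm {A B : Finset V} (h : TightEdge G u v A B) : TightEdge G v u B A := by
  refine ⟨h.adj.symm, h.mem_right, h.mem_left, h.nonempty_right, h.nonempty_left, h.exists_right,
    h.exists_left, ?_, ?_, ?_, ?_, ?_⟩ <;> rw [Finset.union_comm] <;>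
    try rw [Finset.inter_comm]
  · intro x y hxy
    have := h.cover x y hxy
    tauto
  · intro x hx y hy hxy
    have := h.cross x hx y hy hxy
    tauto
  · exact h.short
  · exact h.cyc_eq
  · exact h.cyc_eq_of_disjoint

omit [DecidableEq V] in
lemma ShortCyclesWithin.of_singleton {a : V} (h : ShortCyclesWithin G K {a}) :
    ShortCyclesWithin G K ∅ := by
  refine ⟨by simp, ?_, ?_⟩
  · intro x hx y hy z hz hxy hyz hzx
    have h1 := h.triangle x hx y hy z hz hxy hyz hzx
    have h2 := h.triangle y hy z hz x hx hyz hzx hxy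
    rw [Finset.mem_singleton] at h1 h2
    exact absurd (h1.trans h2.symm) hxy.ne
  · intro x hx y hy z hz t ht hxy hyz hzt htx hxz hyt
    have h1 := h.square x hx y hy z hz t ht hxy hyz hzt htx hxz hyt
    have h2 := h.square y hy z hz t ht x hx hyz hzt htx hxy hyt hxz.symm
    rw [Finset.mem_singleton] at h1 h2
    exact absurd (h1.trans h2.symm) hxy.ne

omit [DecidableEq V] in
lemma ShortCyclesWithin.mono {K' W : Finset V} (h : ShortCyclesWithin G K W) (hK : K' ⊆ K) :
    ShortCyclesWithin G K' W :=
  ⟨fun x hx => h.eq_of_adj x (hK hx),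
    fun x hx y hy z hz => h.triangle x (hK hx) y (hK hy) z (hK hz),
    fun x hx y hy z hz t ht => h.square x (hK hx) y (hK hy) z (hK hz) t (hK ht)⟩

lemma MaxLink.tightEdge [Fintype V] (h : MaxLink G u v K) (hgain : edgeGain G u v = 8 * cyc G + 4)
    (hb : ∀ x y, G.Adj x y → (G.deleteEdges {s(x, y)}).Reachable x y) :
    TightEdge G u v (nbrsIn G K u) (nbrsIn G K v) := by
  have h1 := h.card_adjPairs_le
  have h2 := h.card_ge_union
  have h3 := h.card_ge_inter
  have h4 := h.card_ge_tree
  have hA : ∀ x, x ∈ nbrsIn G K u → x ∈ K ∧ G.Adj u x := fun x hx => mem_nbrsIn.1 hx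
  have hB : ∀ x, x ∈ nbrsIn G K v → x ∈ K ∧ G.Adj v x := fun x hx => mem_nbrsIn.1 hx
  have hAn := h.nonempty_nbrsIn
  have hBn := h.symm.nonempty_nbrsIn
  have hAK : nbrsIn G K u ⊆ K := nbrsIn_subset
  have hBK : nbrsIn G K v ⊆ K := nbrsIn_subset
  rw [h.edgeGain_eq] at hgain
  have hA' : ∀ x, x ∈ K → G.Adj u x → x ∈ nbrsIn G K u := fun x h1 h2 => mem_nbrsIn.2 ⟨h1, h2⟩
  have hB' : ∀ x, x ∈ K → G.Adj v x → x ∈ nbrsIn G K v := fun x h1 h2 => mem_nbrsIn.2 ⟨h1, h2⟩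
  generalize nbrsIn G K u = A at *
  generalize nbrsIn G K v = B at *
  have h5 := card_adjPairs_union (G := G) (A := A) (B := B)
  have h6 := card_le_card (adjPairs_union_subset (G := G) (A := A) (B := B))
  have h7 := Finset.card_union_add_card_inter A B
  have h8 := card_le_card (attached_subset (G := G) (A := A) (B := B))
  have h9 := card_le_card (attached_subset (G := G) (A := B) (B := A))
  have hu : u ∉ A ∪ B := fun hx =>
    h.notMem_left (Finset.union_subset hAK hBK hx)
  have hv : v ∉ A ∪ B := fun hx =>
    h.notMem_right (Finset.union_subset hAK hBK hx)
  have h10 := card_adjPairs_insert_insert (G := G) (K := A ∪ B) h.adj hu hv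
    (fun x hx => ⟨Finset.mem_union_left _ hx, (hA x hx).2⟩)
    (fun x hx => ⟨Finset.mem_union_right _ hx, (hB x hx).2⟩)
  have h11 := card_insert_insert h.adj.ne hu hv
  have tight : (attached G A B).card = B.card ∧ (attached G B A).card = A.card ∧
      (adjPairs G (A ∪ B) (A ∪ B)).card ≤ (adjPairs G A B ∪ adjPairs G B A).card ∧
      2 * cyc G + 2 * (insert u (insert v (A ∪ B))).card ≤
        (adjPairs G (insert u (insert v (A ∪ B))) (insert u (insert v (A ∪ B)))).card + 2 ∧
      ((A ∩ B).Nonempty →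
        2 * cyc G = (adjPairs G (A ∩ B) (A ∩ B)).card + 2 * (A ∪ B).card) ∧
      (A ∩ B = ∅ → cyc G + 1 = (A ∪ B).card) ∧ ShortCyclesWithin G K (A ∩ B) := by
    rcases (A ∩ B).eq_empty_or_nonempty with hZ | hZ
    · rw [if_neg (Finset.not_nonempty_iff_eq_empty.2 hZ)] at hgain
      rw [hZ] at h5 h7
      rw [Finset.card_empty] at h7
      rw [adjPairs_empty_left, Finset.card_empty] at h5
      refine ⟨by omega, by omega, by omega, by omega, fun hZ' => absurd hZ hZ'.ne_empty,
        fun _ => by omega, ?_⟩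
      rw [hZ]
      obtain ⟨a, ha⟩ := hAn
      have hW : {a} ⊆ K := Finset.singleton_subset_iff.2 (hAK ha)
      refine (shortCyclesWithin_of_card_le h.connected (Finset.singleton_nonempty a) hW
        ?_).of_singleton
      have h12 := Finset.card_sdiff_add_card_eq_card hW
      rw [Finset.card_singleton] at h12
      omega
    · have h3 := h3 hZ
      rw [if_pos hZ] at hgain
      refine ⟨by omega, by omega, by omega, by omega, fun _ => by omega,
        fun hZ' => absurd hZ' hZ.ne_empty, ?_⟩
      have hW : A ∩ B ⊆ K := Finset.inter_subset_left.trans hAK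
      refine shortCyclesWithin_of_card_le h.connected hZ hW ?_
      have h12 := Finset.card_sdiff_add_card_eq_card hW
      omega
  clear h1 h2 h3 h4 h5 h6 h7 h8 h9 h10 h11 hgain
  obtain ⟨t1, t2, t3, t4, t5, t6, t7⟩ := tight
  have t1' := Finset.eq_of_subset_of_card_le attached_subset t1.ge
  have t2' := Finset.eq_of_subset_of_card_le attached_subset t2.ge
  have t3' := Finset.eq_of_subset_of_card_le adjPairs_union_subset t3
  have hcover : ∀ x y, G.Adj x y → x = u ∨ x = v ∨ x ∈ A ∪ B := fun x y hxy => by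
    simpa only [Finset.mem_insert] using mem_of_cyc_le (Finset.insert_nonempty _ _) hb t4 hxy
  refine ⟨h.adj, fun x => ⟨fun hx => ⟨(hA x hx).2, fun he => h.notMem_right (he ▸ hAK hx)⟩, ?_⟩,
    fun x => ⟨fun hx => ⟨(hB x hx).2, fun he => h.notMem_left (he ▸ hBK hx)⟩, ?_⟩, hAn, hBn,
    fun x hx hxB => ?_, fun x hx hxA => ?_, hcover, fun x hx y hy hxy => ?_, ?_, t5, t6⟩
  · rintro ⟨hux, hxv⟩
    have := ((hcover x u hux.symm).resolve_left hux.ne.symm).resolve_left hxv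
    exact hA' x (Finset.union_subset hAK hBK this) hux
  · rintro ⟨hvx, hxu⟩
    have := ((hcover x v hvx.symm).resolve_left hxu).resolve_left hvx.ne.symm
    exact hB' x (Finset.union_subset hAK hBK this) hvx
  · rw [← t2', mem_attached] at hx
    exact hx.2.resolve_left hxB
  · rw [← t1', mem_attached] at hx
    exact hx.2.resolve_left hxA
  · have : (x, y) ∈ adjPairs G (A ∪ B) (A ∪ B) := mem_adjPairs.2 ⟨⟨hx, hy⟩, hxy⟩
    rw [← t3', Finset.mem_union, mem_adjPairs, mem_adjPairs] at this
    tauto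
  · exact t7.mono (Finset.union_subset hAK hBK)

end TightEdge

section Saturated

variable {V : Type*} [Fintype V]

/-- The vertices `a` and `b` have so many common neighbours that the cycles through both of
them account for the whole cyclomatic number. -/
def SaturatedPair (G : SimpleGraph V) (a b : V) : Prop :=
  a ≠ b ∧ (cyc G < (commonNbrs G a b).card ∨ G.Adj a b ∧ cyc G ≤ (commonNbrs G a b).card)

/-- The graphs that may attain equality in `score_le`. -/
def Saturated (G : SimpleGraph V) : Prop :=
  cyc G = 0 ∨ (∃ a b, SaturatedPair G a b) ∨ cyc G = 3 ∧ ∃ s, G.IsNClique 4 s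

variable [DecidableEq V] {G : SimpleGraph V} {u v a b w : V} {A B : Finset V}

omit [DecidableEq V] in
lemma SaturatedPair.symm (h : SaturatedPair G a b) : SaturatedPair G b a := by
  unfold SaturatedPair at *
  rwa [commonNbrs_comm, ne_comm, G.adj_comm]

namespace TightEdge

lemma commonNbrs_eq (h : TightEdge G u v A B) : commonNbrs G u v = A ∩ B := by
  ext z
  rw [mem_commonNbrs, Finset.mem_inter, h.mem_left, h.mem_right]
  exact ⟨fun hz => ⟨⟨hz.1, hz.2.ne.symm⟩, hz.2, hz.1.ne.symm⟩, fun hz => ⟨hz.1.1, hz.2.1⟩⟩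

lemma saturatedPair_of_eq (h : TightEdge G u v A B) (hAB : A = B)
    (ho : (adjPairs G (A ∩ B) (A ∩ B)).card = 0) : SaturatedPair G u v := by
  have h1 : (A ∩ B).Nonempty := by
    rw [← hAB, Finset.inter_self]
    exact h.nonempty_left
  have h2 := h.cyc_eq h1
  refine ⟨h.adj.ne, Or.inr ⟨h.adj, ?_⟩⟩
  rw [h.commonNbrs_eq]
  rw [ho] at h2
  subst hAB
  rw [Finset.inter_self]
  rw [Finset.union_self] at h2
  omega

lemma saturatedPair_of_subset (h : TightEdge G u v A B) (hBA : B ⊆ A) (hZ : (A ∩ B).card = 1) :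
    ∃ z, SaturatedPair G u z := by
  obtain ⟨z, hz⟩ := Finset.card_eq_one.1 hZ
  have hB : B = {z} := by rw [← hz, Finset.inter_eq_right.2 hBA]
  have hzA : z ∈ A := hBA (by simp [hB])
  have h2 := h.cyc_eq (Finset.card_pos.1 (by omega))
  have ho : adjPairs G (A ∩ B) (A ∩ B) = ∅ := by
    ext p
    simp only [hz, mem_adjPairs, Finset.mem_singleton, Finset.notMem_empty, iff_false]
    rintro ⟨⟨h1, h2⟩, h3⟩
    exact h3.ne (h1.trans h2.symm)
  rw [ho, Finset.union_eq_left.2 hBA, Finset.card_empty] at h2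
  have huz := (h.mem_left z).1 hzA
  have hvz := (h.mem_right z).1 (by simp [hB])
  have hsub : insert v (A.erase z) ⊆ commonNbrs G u z := by
    intro x hx
    rw [mem_commonNbrs]
    rcases Finset.mem_insert.1 hx with rfl | hx
    · exact ⟨h.adj, hvz.1.symm⟩
    · rw [Finset.mem_erase] at hx
      obtain ⟨y, hy, hxy⟩ := h.exists_left x hx.2 (by simp [hB, hx.1])
      rw [hB, Finset.mem_singleton] at hy
      exact ⟨((h.mem_left x).1 hx.2).1, hy ▸ hxy.symm⟩
  have h3 := card_le_card hsub
  rw [card_insert_of_notMem (fun hv => ((h.mem_left v).1 (Finset.mem_of_mem_erase hv)).2 rfl),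
    card_erase_of_mem hzA] at h3
  have := Finset.card_pos.2 ⟨z, hzA⟩
  exact ⟨z, huz.1.ne, Or.inr ⟨huz.1, by omega⟩⟩

lemma saturatedPair_of_card_eq_one (h : TightEdge G u v A B) (hAB : A ∩ B = ∅) (hA : A.card = 1) :
    ∃ x, SaturatedPair G x v := by
  obtain ⟨x, hx⟩ := Finset.card_eq_one.1 hA
  have hxA : x ∈ A := by simp [hx]
  have hux := (h.mem_left x).1 hxA
  have h2 := h.cyc_eq_of_disjoint hAB
  have h3 := Finset.card_union_add_card_inter A B
  rw [hAB, Finset.card_empty] at h3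
  have hsub : insert u B ⊆ commonNbrs G x v := by
    intro y hy
    rw [mem_commonNbrs]
    rcases Finset.mem_insert.1 hy with rfl | hy
    · exact ⟨hux.1.symm, h.adj.symm⟩
    · have hyA : y ∉ A := fun hyA => by
        have : y ∈ A ∩ B := Finset.mem_inter.2 ⟨hyA, hy⟩
        rw [hAB] at this
        simp at this
      obtain ⟨z, hz, hyz⟩ := h.exists_right y hy hyA
      rw [hx, Finset.mem_singleton] at hz
      exact ⟨hz ▸ hyz.symm, ((h.mem_right y).1 hy).1⟩
  have h4 := card_le_card hsub
  rw [card_insert_of_notMem (fun hu => ((h.mem_right u).1 hu).2 rfl)] at h4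
  exact ⟨x, hux.2, Or.inl (by omega)⟩

lemma saturated_of_card_eq_two (h : TightEdge G u v A B) (hAB : A = B) (hA : A.card = 2) :
    Saturated G := by
  by_cases ho : (adjPairs G (A ∩ B) (A ∩ B)).card = 0
  · exact Or.inr (Or.inl ⟨u, v, h.saturatedPair_of_eq hAB ho⟩)
  subst hAB
  have h2 := h.cyc_eq (by rw [Finset.inter_self]; exact h.nonempty_left)
  rw [Finset.inter_self, Finset.union_self] at h2
  rw [Finset.inter_self] at ho
  obtain ⟨x, y, hxy, rfl⟩ := Finset.card_eq_two.1 hA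
  have hux := (h.mem_left x).1 (by simp)
  have huy := (h.mem_left y).1 (by simp)
  have hvx := (h.mem_right x).1 (by simp)
  have hvy := (h.mem_right y).1 (by simp)
  obtain ⟨p, hp⟩ := Finset.card_pos.1 (Nat.pos_of_ne_zero ho)
  rw [mem_adjPairs] at hp
  have hadj : G.Adj x y := by
    have := hp.2.ne
    have := hp.2.symm
    simp only [Finset.mem_insert, Finset.mem_singleton] at hp
    grind
  have hcard : (adjPairs G {x, y} {x, y}).card = 2 := by
    rw [show adjPairs G {x, y} {x, y} = {(x, y), (y, x)} from ?_, Finset.card_pair]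
    · simp [hxy]
    · ext ⟨s, t⟩
      simp only [mem_adjPairs, Finset.mem_insert, Finset.mem_singleton, Prod.mk.injEq]
      constructor
      · rintro ⟨⟨rfl | rfl, rfl | rfl⟩, h⟩ <;> simp_all
      · rintro (⟨rfl, rfl⟩ | ⟨rfl, rfl⟩)
        · simp [hadj]
        · simp [hadj.symm]
  refine Or.inr (Or.inr ⟨by omega, {u, v, x, y}, ?_⟩)
  refine ((is3Clique_triple_iff.2 ⟨hvx.1, hvy.1, hadj⟩).insert ?_)
  simp [h.adj, hux.1, huy.1]

lemma three_le_cyc (h : TightEdge G u v A B) (hS : ¬ Saturated G) : 3 ≤ cyc G := by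
  have h3 := Finset.card_union_add_card_inter A B
  have hAl := card_le_card (Finset.inter_subset_left (s₁ := A) (s₂ := B))
  have hBl := card_le_card (Finset.inter_subset_right (s₁ := A) (s₂ := B))
  rcases (A ∩ B).eq_empty_or_nonempty with hZ | hZ
  · have h1 := h.cyc_eq_of_disjoint hZ
    have h2 : A.card ≠ 1 := fun hA => by
      obtain ⟨x, hx⟩ := h.saturatedPair_of_card_eq_one hZ hA
      exact hS (Or.inr (Or.inl ⟨_, _, hx⟩))
    have h2' : B.card ≠ 1 := fun hB => by
      obtain ⟨x, hx⟩ := h.symm.saturatedPair_of_card_eq_one (by rwa [Finset.inter_comm]) hB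
      exact hS (Or.inr (Or.inl ⟨_, _, hx⟩))
    have := h.nonempty_left.card_pos
    have := h.nonempty_right.card_pos
    rw [hZ, Finset.card_empty] at h3
    omega
  · have h1 := h.cyc_eq hZ
    have h4 := hZ.card_pos
    by_cases hc1 : (A ∩ B).card = 1
    · have hBA : (A ∩ B).card ≠ B.card := fun hc => by
        obtain ⟨z, hz⟩ := h.saturatedPair_of_subset
          (Finset.inter_eq_right.1 (Finset.eq_of_subset_of_card_le Finset.inter_subset_right hc.ge))
          hc1
        exact hS (Or.inr (Or.inl ⟨_, _, hz⟩))
      have hAB : (A ∩ B).card ≠ A.card := fun hc => by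
        obtain ⟨z, hz⟩ := h.symm.saturatedPair_of_subset
          (Finset.inter_eq_left.1 (Finset.eq_of_subset_of_card_le Finset.inter_subset_left hc.ge))
          (by rwa [Finset.inter_comm])
        exact hS (Or.inr (Or.inl ⟨_, _, hz⟩))
      omega
    · by_cases hc2 : (A ∪ B).card = 2
      · have e1 : A ∩ B = A := Finset.eq_of_subset_of_card_le Finset.inter_subset_left (by omega)
        have e2 : A ∩ B = B := Finset.eq_of_subset_of_card_le Finset.inter_subset_right (by omega)
        exact absurd (h.saturated_of_card_eq_two (e1.symm.trans e2) (by omega)) hS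
      · omega

lemma card_inter_lt_cyc (h : TightEdge G u v A B) (hS : ¬ Saturated G) :
    (A ∩ B).card < cyc G := by
  have h3 := Finset.card_union_add_card_inter A B
  have hAl := card_le_card (Finset.inter_subset_left (s₁ := A) (s₂ := B))
  have hBl := card_le_card (Finset.inter_subset_right (s₁ := A) (s₂ := B))
  rcases (A ∩ B).eq_empty_or_nonempty with hZ | hZ
  · have := h.three_le_cyc hS
    rw [hZ, Finset.card_empty]
    omega
  · have h1 := h.cyc_eq hZ
    by_contra hc
    have e1 : A ∩ B = A := Finset.eq_of_subset_of_card_le Finset.inter_subset_left (by omega)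
    have e2 : A ∩ B = B := Finset.eq_of_subset_of_card_le Finset.inter_subset_right (by omega)
    exact hS (Or.inr (Or.inl ⟨_, _, h.saturatedPair_of_eq (e1.symm.trans e2) (by omega)⟩))

end TightEdge

end Saturated

section Deletion

variable {V : Type*} [Fintype V] [DecidableEq V] {G : SimpleGraph V} {u v a b w : V}
  {A B : Finset V}

namespace TightEdge

omit [Fintype V] [DecidableEq V] in
lemma adj_deleteEdges {x y : V} : (G.deleteEdges {s(u, v)}).Adj x y ↔
    G.Adj x y ∧ ¬ (x = u ∧ y = v) ∧ ¬ (x = v ∧ y = u) := by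
  simp only [deleteEdges_adj, Set.mem_singleton_iff, Sym2.eq_iff, not_or]

omit [Fintype V] in
lemma left_mem (h : TightEdge G u v A B) {x : V} (hx : x ∈ A ∪ B) : x ≠ u ∧ x ≠ v := by
  rw [Finset.mem_union, h.mem_left, h.mem_right] at hx
  rcases hx with hx | hx
  · exact ⟨hx.1.ne.symm, hx.2⟩
  · exact ⟨hx.2, hx.1.ne.symm⟩

lemma not_saturatedPair_left (h : TightEdge G u v A B) (hS : ¬ Saturated G)
    (hc : cyc (G.deleteEdges {s(u, v)}) + 1 = cyc G) (hw : w ∈ A ∪ B) :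
    ¬ SaturatedPair (G.deleteEdges {s(u, v)}) u w := by
  classical
  have hc3 := h.three_le_cyc hS
  have hcard := Finset.card_union_add_card_inter A B
  have hAl := card_le_card (Finset.inter_subset_left (s₁ := A) (s₂ := B))
  have hBl := card_le_card (Finset.inter_subset_right (s₁ := A) (s₂ := B))
  have hk : (commonNbrs (G.deleteEdges {s(u, v)}) u w).card ≤
      ({y ∈ A ∩ B | G.Adj w y} : Finset V).card + (A \ (A ∩ B)).card := by
    refine (card_le_card ?_).trans (Finset.card_union_le _ _)
    intro y hy
    rw [mem_commonNbrs, adj_deleteEdges, adj_deleteEdges] at hy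
    have hyA : y ∈ A := (h.mem_left y).2 ⟨hy.1.1, fun hyv => hy.1.2.1 ⟨rfl, hyv⟩⟩
    simp only [Finset.mem_union, Finset.mem_filter, Finset.mem_sdiff, hyA, hy.2.1, and_true,
      true_and]
    exact em _
  rw [card_sdiff_of_subset Finset.inter_subset_left] at hk
  have hT : w ∉ A ∩ B → ({y ∈ A ∩ B | G.Adj w y} : Finset V).card ≤ 1 := by
    intro hwZ
    rw [Finset.card_le_one]
    intro y hy z hz
    rw [Finset.mem_filter] at hy hz
    exact h.short.eq_of_adj w hw hwZ y hy.1 z hz.1 hy.2 hz.2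
  rintro ⟨-, hsat⟩
  by_cases hwZ : w ∈ A ∩ B
  · have h1 := card_adjPairs_insert_ge (G := G) (u := w) (K := (A ∩ B).erase w)
      (T := {y ∈ A ∩ B | G.Adj w y}) (by simp) (by
        intro y hy
        rw [Finset.mem_filter] at hy
        exact Finset.mem_erase.2 ⟨hy.2.ne.symm, hy.1⟩) (fun y hy => (Finset.mem_filter.1 hy).2)
    rw [Finset.insert_erase hwZ] at h1
    have h2 := h.cyc_eq ⟨w, hwZ⟩
    have h3 := Finset.card_pos.2 ⟨w, hwZ⟩
    have h4 : B.card ≠ 1 := fun hB => by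
      obtain ⟨z, hz⟩ := h.saturatedPair_of_subset (Finset.inter_eq_right.1
        (Finset.eq_of_subset_of_card_le Finset.inter_subset_right (by omega))) (by omega)
      exact hS (Or.inr (Or.inl ⟨_, _, hz⟩))
    omega
  · have h1 := hT hwZ
    by_cases hwA : w ∈ A
    · have h2 : (commonNbrs (G.deleteEdges {s(u, v)}) u w).card ≤ 1 := by
        refine (card_le_card ?_).trans h1
        intro y hy
        rw [mem_commonNbrs, adj_deleteEdges, adj_deleteEdges] at hy
        have hyA : y ∈ A := (h.mem_left y).2 ⟨hy.1.1, fun hyv => hy.1.2.1 ⟨rfl, hyv⟩⟩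
        have h3 := h.cross w hw y (Finset.mem_union_left _ hyA) hy.2.1
        simp only [Finset.mem_inter, Finset.mem_filter] at hwZ ⊢
        exact ⟨⟨hyA, by tauto⟩, hy.2.1⟩
      omega
    · have hwB : w ∈ B := (Finset.mem_union.1 hw).resolve_left hwA
      have hnadj : ¬ (G.deleteEdges {s(u, v)}).Adj u w := fun hadj =>
        hwA ((h.mem_left w).2 ⟨(adj_deleteEdges.1 hadj).1, (h.left_mem hw).2⟩)
      simp only [hnadj, false_and, or_false] at hsat
      have h5 : (A ∩ B).card < B.card := Finset.card_lt_card
        ⟨Finset.inter_subset_right, fun hBA => hwZ (hBA hwB)⟩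
      rcases (A ∩ B).eq_empty_or_nonempty with hZ | hZ
      · have h2 := h.cyc_eq_of_disjoint hZ
        have h3 : B.card ≠ 1 := fun hB => by
          obtain ⟨x, hx⟩ := h.symm.saturatedPair_of_card_eq_one (by rwa [Finset.inter_comm]) hB
          exact hS (Or.inr (Or.inl ⟨_, _, hx⟩))
        have h4 : ({y ∈ A ∩ B | G.Adj w y} : Finset V).card = 0 := by simp [hZ]
        omega
      · have h2 := h.cyc_eq hZ
        have h3 := hZ.card_pos
        omega

lemma not_saturatedPair_self (h : TightEdge G u v A B) (hS : ¬ Saturated G)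
    (hc : cyc (G.deleteEdges {s(u, v)}) + 1 = cyc G) :
    ¬ SaturatedPair (G.deleteEdges {s(u, v)}) u v := by
  have h1 := h.card_inter_lt_cyc hS
  have h2 : (commonNbrs (G.deleteEdges {s(u, v)}) u v).card ≤ (A ∩ B).card := by
    rw [← h.commonNbrs_eq]
    refine card_le_card fun y hy => ?_
    rw [mem_commonNbrs, adj_deleteEdges, adj_deleteEdges] at hy
    exact mem_commonNbrs.2 ⟨hy.1.1, hy.2.1⟩
  rintro ⟨-, hsat | ⟨hadj, -⟩⟩
  · omega
  · exact (adj_deleteEdges.1 hadj).2.1 ⟨rfl, rfl⟩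

lemma not_saturatedPair_inner (h : TightEdge G u v A B) (hS : ¬ Saturated G)
    (hc : cyc (G.deleteEdges {s(u, v)}) + 1 = cyc G) (ha : a ∈ A ∪ B) (hb : b ∈ A ∪ B) :
    ¬ SaturatedPair (G.deleteEdges {s(u, v)}) a b := by
  classical
  have hc3 := h.three_le_cyc hS
  rintro ⟨hab, hsat⟩
  have hcard := Finset.card_union_add_card_inter A B
  have hAl := card_le_card (Finset.inter_subset_left (s₁ := A) (s₂ := B))
  have hBl := card_le_card (Finset.inter_subset_right (s₁ := A) (s₂ := B))
  set T : Finset V := {y ∈ A ∪ B | G.Adj a y ∧ G.Adj b y} with hT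
  have hmemT : ∀ y, y ∈ commonNbrs (G.deleteEdges {s(u, v)}) a b → y = u ∨ y = v ∨ y ∈ T := by
    intro y hy
    rw [mem_commonNbrs, adj_deleteEdges, adj_deleteEdges] at hy
    have := h.cover y a hy.1.1.symm
    rw [hT, Finset.mem_filter]
    tauto
  by_cases hZ : a ∈ A ∩ B ∧ b ∈ A ∩ B
  · have hk : (commonNbrs (G.deleteEdges {s(u, v)}) a b).card ≤ 2 + T.card := by
      refine (card_le_card (t := {u, v} ∪ T) ?_).trans ((Finset.card_union_le _ _).trans
        (Nat.add_le_add_right Finset.card_le_two _))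
      intro y hy
      have := hmemT y hy
      simp only [Finset.mem_union, Finset.mem_insert, Finset.mem_singleton]
      tauto
    have hTZ : T ⊆ A ∩ B := by
      intro y hy
      rw [hT, Finset.mem_filter] at hy
      by_contra hyZ
      exact hab (h.short.eq_of_adj y hy.1 hyZ a hZ.1 b hZ.2 hy.2.1.symm hy.2.2.symm)
    have ho : 4 * T.card ≤ (adjPairs G (A ∩ B) (A ∩ B)).card ∧
        (G.Adj a b → 4 * T.card + 2 ≤ (adjPairs G (A ∩ B) (A ∩ B)).card) := by
      have haT : a ∉ T := by simp [hT]
      have hbT : b ∉ T := by simp [hT]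
      have hsub : insert a (insert b T) ⊆ A ∩ B := by
        simp only [Finset.insert_subset_iff, hTZ, hZ, and_self]
      have h1 := card_le_card (adjPairs_mono (G := G) hsub hsub)
      have h2 := card_adjPairs_insert_ge hbT subset_rfl
        (fun y hy => ((Finset.mem_filter.1 hy).2.2 : G.Adj b y))
      have h3 := card_adjPairs_insert_ge (G := G) (u := a) (K := insert b T) (T := T)
        (by simp [hab, haT]) (Finset.subset_insert _ _)
        (fun y hy => ((Finset.mem_filter.1 hy).2.1 : G.Adj a y))
      refine ⟨by omega, fun hadj => ?_⟩
      have h4 := card_adjPairs_insert_insert hadj haT hbT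
        (A := T) (B := T) (fun y hy => ⟨hy, (Finset.mem_filter.1 hy).2.1⟩)
        (fun y hy => ⟨hy, (Finset.mem_filter.1 hy).2.2⟩)
      omega
    have h2 := h.cyc_eq ⟨a, hZ.1⟩
    have h3 : 2 ≤ (A ∩ B).card := Finset.one_lt_card.2 ⟨a, hZ.1, b, hZ.2, hab⟩
    have h4 : (A ∪ B).card ≠ 2 := fun hc2 => by
      have e1 : A ∩ B = A := Finset.eq_of_subset_of_card_le Finset.inter_subset_left (by omega)
      have e2 : A ∩ B = B := Finset.eq_of_subset_of_card_le Finset.inter_subset_right (by omega)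
      exact hS (h.saturated_of_card_eq_two (e1.symm.trans e2) (by omega))
    have h5 := fun hadj : (G.deleteEdges {s(u, v)}).Adj a b => ho.2 (adj_deleteEdges.1 hadj).1
    by_cases hadj : (G.deleteEdges {s(u, v)}).Adj a b
    · have := h5 hadj
      omega
    · simp only [hadj, false_and, or_false] at hsat
      omega
  · have hT1 : T.card ≤ 1 ∧ (G.Adj a b → T.card = 0) := by
      have hZ' : a ∉ A ∩ B ∨ b ∉ A ∩ B := by tauto
      constructor
      · rw [Finset.card_le_one]
        intro y hy z hz
        rw [hT, Finset.mem_filter] at hy hz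
        by_contra hyz
        rcases hZ' with hZ' | hZ'
        · exact hZ' (h.short.square a ha y hy.1 b hb z hz.1 hy.2.1 hy.2.2.symm hz.2.2
            hz.2.1.symm hab hyz)
        · exact hZ' (h.short.square b hb y hy.1 a ha z hz.1 hy.2.2 hy.2.1.symm hz.2.1
            hz.2.2.symm hab.symm hyz)
      · intro hadj
        rw [Finset.card_eq_zero, Finset.eq_empty_iff_forall_notMem]
        intro y hy
        rw [hT, Finset.mem_filter] at hy
        rcases hZ' with hZ' | hZ'
        · exact hZ' (h.short.triangle a ha b hb y hy.1 hadj hy.2.2 hy.2.1.symm)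
        · exact hZ' (h.short.triangle b hb a ha y hy.1 hadj.symm hy.2.1 hy.2.2.symm)
    obtain ⟨x, hx⟩ : ∃ x, commonNbrs (G.deleteEdges {s(u, v)}) a b ⊆ insert x T := by
      by_cases hu : G.Adj u a ∧ G.Adj u b
      · refine ⟨u, fun y hy => ?_⟩
        have h1 := hmemT y hy
        have h2 : y ≠ v := by
          rintro rfl
          rw [mem_commonNbrs, adj_deleteEdges, adj_deleteEdges] at hy
          apply hZ
          simp only [Finset.mem_inter, h.mem_left, h.mem_right]
          exact ⟨⟨⟨hu.1, (h.left_mem ha).2⟩, hy.1.1.symm, (h.left_mem ha).1⟩,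
            ⟨⟨hu.2, (h.left_mem hb).2⟩, hy.2.1.symm, (h.left_mem hb).1⟩⟩
        rw [Finset.mem_insert]
        tauto
      · refine ⟨v, fun y hy => ?_⟩
        have h1 := hmemT y hy
        have h2 : y ≠ u := by
          rintro rfl
          rw [mem_commonNbrs, adj_deleteEdges, adj_deleteEdges] at hy
          exact hu ⟨hy.1.1.symm, hy.2.1.symm⟩
        rw [Finset.mem_insert]
        tauto
    have hk := (card_le_card hx).trans (Finset.card_insert_le _ _)
    have h5 := fun hadj : (G.deleteEdges {s(u, v)}).Adj a b => hT1.2 (adj_deleteEdges.1 hadj).1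
    by_cases hadj : (G.deleteEdges {s(u, v)}).Adj a b
    · have := h5 hadj
      omega
    · simp only [hadj, false_and, or_false] at hsat
      omega

lemma not_saturatedPair (h : TightEdge G u v A B) (hS : ¬ Saturated G)
    (hc : cyc (G.deleteEdges {s(u, v)}) + 1 = cyc G) :
    ¬ SaturatedPair (G.deleteEdges {s(u, v)}) a b := by
  intro hab
  have hs : s(v, u) = s(u, v) := Sym2.eq_swap
  have hc3 := h.three_le_cyc hS
  have key : ∀ x y, SaturatedPair (G.deleteEdges {s(u, v)}) x y → x = u ∨ x = v ∨ x ∈ A ∪ B := by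
    intro x y hxy
    by_contra hx
    have h1 : commonNbrs (G.deleteEdges {s(u, v)}) x y = ∅ := by
      rw [Finset.eq_empty_iff_forall_notMem]
      intro z hz
      rw [mem_commonNbrs, adj_deleteEdges] at hz
      exact hx (h.cover x z hz.1.1)
    have h2 := hxy.2
    rw [h1, Finset.card_empty] at h2
    omega
  have hl : ∀ w ∈ A ∪ B, ¬ SaturatedPair (G.deleteEdges {s(u, v)}) u w := fun w hw =>
    h.not_saturatedPair_left hS hc hw
  have hr : ∀ w ∈ A ∪ B, ¬ SaturatedPair (G.deleteEdges {s(u, v)}) v w := fun w hw => by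
    rw [← hs]
    exact h.symm.not_saturatedPair_left hS (by rwa [hs]) (by rwa [Finset.union_comm])
  have hne := hab.1
  have huv := h.not_saturatedPair_self hS hc
  rcases key _ _ hab with rfl | rfl | ha <;> rcases key _ _ hab.symm with rfl | rfl | hb
  · exact hne rfl
  · exact huv hab
  · exact hl _ hb hab
  · exact huv hab.symm
  · exact hne rfl
  · exact hr _ hb hab
  · exact hl _ ha hab.symm
  · exact hr _ ha hab.symm
  · exact h.not_saturatedPair_inner hS hc ha hb hab

omit [Fintype V] in
lemma not_isNClique (h : TightEdge G u v A B) (hc : cyc G = 4) (s : Finset V) :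
    ¬ (G.deleteEdges {s(u, v)}).IsNClique 4 s := by
  intro hs
  have hadj : ∀ x ∈ s, ∀ y ∈ s, x ≠ y → (G.deleteEdges {s(u, v)}).Adj x y :=
    fun x hx y hy hxy => hs.1 hx hy hxy
  have hadj' : ∀ x ∈ s, ∀ y ∈ s, x ≠ y → G.Adj x y := fun x hx y hy hxy =>
    (adj_deleteEdges.1 (hadj x hx y hy hxy)).1
  obtain ⟨t, hts, ht⟩ : ∃ t ⊆ s, t.card = 3 ∧ ∀ x ∈ t, x ≠ u ∧ x ≠ v := by
    obtain ⟨p, hp, hp'⟩ : ∃ p ∈ s, ∀ x ∈ s.erase p, x ≠ u ∧ x ≠ v := by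
      have huv : ¬ (u ∈ s ∧ v ∈ s) := fun huv =>
        (adj_deleteEdges.1 (hadj u huv.1 v huv.2 h.adj.ne)).2.1 ⟨rfl, rfl⟩
      by_cases hu : u ∈ s
      · refine ⟨u, hu, fun x hx => ?_⟩
        rw [Finset.mem_erase] at hx
        exact ⟨hx.1, fun hxv => huv ⟨hu, hxv ▸ hx.2⟩⟩
      · by_cases hv : v ∈ s
        · refine ⟨v, hv, fun x hx => ?_⟩
          rw [Finset.mem_erase] at hx
          exact ⟨fun hxu => hu (hxu ▸ hx.2), hx.1⟩
        · obtain ⟨p, hp⟩ := Finset.card_pos.1 (by rw [hs.2]; norm_num : 0 < s.card)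
          refine ⟨p, hp, fun x hx => ?_⟩
          rw [Finset.mem_erase] at hx
          exact ⟨fun hxu => hu (hxu ▸ hx.2), fun hxv => hv (hxv ▸ hx.2)⟩
    exact ⟨s.erase p, Finset.erase_subset _ _, by rw [card_erase_of_mem hp, hs.2], hp'⟩
  obtain ⟨x, y, z, hxy, hxz, hyz, rfl⟩ := Finset.card_eq_three.1 ht.1
  have hx : x ∈ s := hts (by simp)
  have hy : y ∈ s := hts (by simp)
  have hz : z ∈ s := hts (by simp)
  have hxy' := hadj' x hx y hy hxy
  have hxz' := hadj' x hx z hz hxz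
  have hyz' := hadj' y hy z hz hyz
  have hU : ∀ r ∈ ({x, y, z} : Finset V), ∀ q, G.Adj r q → r ∈ A ∪ B := fun r hr q hrq => by
    have := h.cover r q hrq
    have := ht.2 r hr
    tauto
  have hxU := hU x (by simp) y hxy'
  have hyU := hU y (by simp) z hyz'
  have hzU := hU z (by simp) x hxz'.symm
  have hxZ := h.short.triangle x hxU y hyU z hzU hxy' hyz' hxz'.symm
  have hyZ := h.short.triangle y hyU z hzU x hxU hyz' hxz'.symm hxy'
  have hzZ := h.short.triangle z hzU x hxU y hyU hxz'.symm hxy' hyz'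
  have hsub : {x, y, z} ⊆ A ∩ B := by
    simp only [Finset.insert_subset_iff, Finset.singleton_subset_iff]
    exact ⟨hxZ, hyZ, hzZ⟩
  have h1 := card_le_card hsub
  have h2 := card_le_card (Finset.inter_subset_union (s := A) (t := B))
  have h3 := h.cyc_eq ⟨x, hxZ⟩
  have h4 := card_adjPairs_insert_insert (G := G) (K := {z}) (A := {z}) (B := {z}) hxy'
    (by simpa using hxz) (by simpa using hyz) (by simpa using hxz') (by simpa using hyz')
  have h5 := card_le_card (adjPairs_mono (G := G) hsub hsub)
  simp only [Finset.card_singleton] at h4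
  omega

theorem saturated (h : TightEdge G u v A B) (hc : cyc (G.deleteEdges {s(u, v)}) + 1 = cyc G)
    (hS : Saturated (G.deleteEdges {s(u, v)})) : Saturated G := by
  by_contra hG
  have hc3 := h.three_le_cyc hG
  rcases hS with hS | ⟨a, b, hab⟩ | ⟨hS, s, hs⟩
  · omega
  · exact h.not_saturatedPair hG hc hab
  · exact h.not_isNClique (by omega) s hs

end TightEdge

end Deletion

section Inequality

variable {V : Type*} [Fintype V] {G : SimpleGraph V} {u v : V}

lemma Saturated.of_deleteEdges (h : Saturated (G.deleteEdges {s(u, v)}))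
    (hc : cyc (G.deleteEdges {s(u, v)}) = cyc G) : Saturated G := by
  have hle : G.deleteEdges {s(u, v)} ≤ G := deleteEdges_le _
  rcases h with h | ⟨a, b, hab, h⟩ | ⟨h, s, hs⟩
  · exact Or.inl (hc ▸ h)
  · refine Or.inr (Or.inl ⟨a, b, hab, ?_⟩)
    have h1 : (commonNbrs (G.deleteEdges {s(u, v)}) a b).card ≤ (commonNbrs G a b).card := by
      refine card_le_card fun z hz => ?_
      rw [mem_commonNbrs] at hz ⊢
      exact ⟨hle hz.1, hle hz.2⟩
    rcases h with h | ⟨hadj, h⟩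
    · exact Or.inl (by omega)
    · exact Or.inr ⟨hle hadj, by omega⟩
  · exact Or.inr (Or.inr ⟨hc ▸ h, s, hs.mono hle⟩)

lemma score_eq_zero (h : G.edgeSet = ∅) : score G = 0 := by
  obtain rfl := edgeSet_eq_empty.1 h
  refine Finset.sum_eq_zero fun x _ => Finset.sum_eq_zero fun y _ => ?_
  have h1 : commonNbrs (⊥ : SimpleGraph V) x y = ∅ := by
    ext z
    simp
  by_cases hxy : x = y
  · simp [hxy]
  · rw [pairScore_of_ne hxy, badPaths_of_not_adj (by simp), h1]
    simp

/-- Nonnegativity of `γ₂`, and the structure of the graphs attaining equality. -/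
theorem score_le [Nonempty V] (G : SimpleGraph V) : score G ≤ 8 * cyc G * (cyc G + 2) ∧
    (score G = 8 * cyc G * (cyc G + 2) → Saturated G) := by
  classical
  induction hn : G.edgeSet.ncard using Nat.strong_induction_on generalizing G with
  | _ n ih =>
  have h0 := cyc_nonneg G
  by_cases hE : G.edgeSet = ∅
  · rw [score_eq_zero hE]
    refine ⟨by positivity, fun h => Or.inl ?_⟩
    nlinarith
  by_cases hz : ∃ u v, G.Adj u v ∧ edgeGain G u v = 0
  · obtain ⟨u, v, huv, hg⟩ := hz
    have h1 := ncard_edgeSet_deleteEdges huv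
    obtain ⟨h2, h3⟩ := ih _ (by omega) (G.deleteEdges {s(u, v)}) rfl
    have h4 := cyc_deleteEdges_le huv
    have h5 := cyc_nonneg (G.deleteEdges {s(u, v)})
    rw [score_deleteEdges huv, hg, mul_zero, add_zero]
    refine ⟨by nlinarith, fun h => ?_⟩
    have h6 : cyc (G.deleteEdges {s(u, v)}) = cyc G := by nlinarith
    exact (h3 (by rw [h, h6])).of_deleteEdges h6
  · push Not at hz
    obtain ⟨e, he⟩ := Set.nonempty_iff_ne_empty.2 hE
    induction e using Sym2.ind with
    | _ x y =>
    obtain ⟨K₀, hK₀⟩ := exists_link he (hz x y he)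
    obtain ⟨u, v, K, hK⟩ := exists_maxLink hK₀
    have huv := hK.adj
    have hb : ∀ x y, G.Adj x y → (G.deleteEdges {s(x, y)}).Reachable x y := fun x y hxy => by
      obtain ⟨K', hK'⟩ := exists_link hxy (hz x y hxy)
      exact hK'.reachable
    have h1 := ncard_edgeSet_deleteEdges huv
    obtain ⟨h2, h3⟩ := ih _ (by omega) (G.deleteEdges {s(u, v)}) rfl
    have h4 := cyc_deleteEdges_of_reachable huv (hb u v huv)
    have h5 := cyc_nonneg (G.deleteEdges {s(u, v)})
    have h6 := hK.edgeGain_le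
    rw [score_deleteEdges huv]
    refine ⟨by nlinarith, fun h => ?_⟩
    have h7 : cyc (G.deleteEdges {s(u, v)}) + 1 = cyc G := by nlinarith
    have h8 : edgeGain G u v = 8 * cyc G + 4 := by nlinarith
    refine (hK.tightEdge h8 hb).saturated h7 (h3 ?_)
    rw [h8] at h
    rw [← h7] at h
    linarith

end Inequality

section BadPairs

variable {V : Type*} {G : SimpleGraph V} {elt : Sym2 V → Sym2 V → Prop} {x y z w : V}

/-- The closed walk `x, y, z, w` is a 4-cycle. -/
structure Square (G : SimpleGraph V) (x y z w : V) : Prop where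
  fst : G.Adj x y
  snd : G.Adj y z
  trd : G.Adj z w
  fth : G.Adj w x
  ne₁ : x ≠ z
  ne₂ : y ≠ w

/-- The edge `e` is not the minimal one of the 4-cycle `x, y, z, w`. -/
def NotMin (elt : Sym2 V → Sym2 V → Prop) (x y z w : V) (e : Sym2 V) : Prop :=
  ∃ f ∈ ({s(x, y), s(y, z), s(z, w), s(w, x)} : Set (Sym2 V)), elt f e

lemma Square.rotate (h : Square G x y z w) : Square G y z w x :=
  ⟨h.snd, h.trd, h.fth, h.fst, h.ne₂, h.ne₁.symm⟩

lemma NotMin.rotate {e : Sym2 V} (h : NotMin elt x y z w e) : NotMin elt y z w x e := by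
  obtain ⟨f, hf, h⟩ := h
  refine ⟨f, ?_, h⟩
  simp only [Set.mem_insert_iff, Set.mem_singleton_iff] at hf ⊢
  tauto

/-- The 2-path `x, y, z` is a bad pair. -/
def BadMid (G : SimpleGraph V) (elt : Sym2 V → Sym2 V → Prop) (x y z : V) : Prop :=
  (G.Adj x y ∧ G.Adj y z ∧ x ≠ z) ∧ (G.Adj x z ∨
    ∃ w, Square G x y z w ∧ NotMin elt x y z w s(x, y) ∧ NotMin elt x y z w s(y, z))

/-- Opposite oriented edges `xy` and `zw` of a 4-cycle are a bad pair. -/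
def BadOpposite (G : SimpleGraph V) (elt : Sym2 V → Sym2 V → Prop) (x y z w : V) : Prop :=
  Square G x y z w ∧ NotMin elt x y z w s(x, y) ∧ NotMin elt x y z w s(z, w)

lemma dartsInCycle_three_iff {a b : G.Dart} : dartsInCycle G a b 3 ↔
    ∃ x y z, (G.Adj x y ∧ G.Adj y z ∧ G.Adj z x) ∧
      (a.toProd = (x, y) ∨ a.toProd = (y, z) ∨ a.toProd = (z, x)) ∧
      (b.toProd = (x, y) ∨ b.toProd = (y, z) ∨ b.toProd = (z, x)) := by
  constructor
  · rintro ⟨u, w, -, hl, ha, hb⟩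
    match w, hl with
    | .cons h1 (.cons h2 (.cons h3 .nil)), _ =>
      refine ⟨_, _, _, ⟨h1, h2, h3⟩, ?_⟩
      simpa [Dart.ext_iff] using And.intro ha hb
  · rintro ⟨x, y, z, ⟨h1, h2, h3⟩, ha, hb⟩
    refine ⟨x, .cons h1 (.cons h2 (.cons h3 .nil)), ?_, rfl, ?_, ?_⟩
    · have := h1.ne
      have := h2.ne
      have := h3.ne
      rw [Walk.isCycle_def, Walk.isTrail_def]
      simp
      grind
    · simpa [Dart.ext_iff] using ha
    · simpa [Dart.ext_iff] using hb

lemma exists_cycle_four_iff {a b : G.Dart} : (∃ (u : V) (w : G.Walk u u), w.IsCycle ∧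
      w.length = 4 ∧ a ∈ w.darts ∧ b ∈ w.darts ∧
        (∃ e ∈ w.edges, elt e a.edge) ∧ (∃ e ∈ w.edges, elt e b.edge)) ↔
    ∃ x y z w, Square G x y z w ∧
      (a.toProd = (x, y) ∨ a.toProd = (y, z) ∨ a.toProd = (z, w) ∨ a.toProd = (w, x)) ∧
      (b.toProd = (x, y) ∨ b.toProd = (y, z) ∨ b.toProd = (z, w) ∨ b.toProd = (w, x)) ∧
      NotMin elt x y z w a.edge ∧ NotMin elt x y z w b.edge := by
  constructor
  · rintro ⟨u, w, hw, hl, ha, hb, hea, heb⟩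
    match w, hl with
    | .cons h1 (.cons h2 (.cons h3 (.cons h4 .nil))), _ =>
      have hn := hw.support_nodup
      simp only [Walk.support_cons, Walk.support_nil, List.tail_cons, List.nodup_cons,
        List.mem_cons, List.not_mem_nil, or_false, not_or] at hn
      refine ⟨_, _, _, _, ⟨h1, h2, h3, h4, Ne.symm hn.2.1.2, hn.1.2.1⟩, ?_⟩
      simpa [Dart.ext_iff, NotMin] using And.intro ha (And.intro hb (And.intro hea heb))
  · rintro ⟨x, y, z, w, ⟨h1, h2, h3, h4, h5, h6⟩, ha, hb, hea, heb⟩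
    refine ⟨x, .cons h1 (.cons h2 (.cons h3 (.cons h4 .nil))), ?_, rfl, ?_, ?_, ?_, ?_⟩
    · have := h1.ne
      have := h2.ne
      have := h3.ne
      have := h4.ne
      rw [Walk.isCycle_def, Walk.isTrail_def]
      simp
      grind
    · simpa [Dart.ext_iff] using ha
    · simpa [Dart.ext_iff] using hb
    · simpa [NotMin] using hea
    · simpa [NotMin] using heb

lemma exists_square_iff {a b : G.Dart} (hab : a ≠ b) : (∃ x y z w, Square G x y z w ∧
      (a.toProd = (x, y) ∨ a.toProd = (y, z) ∨ a.toProd = (z, w) ∨ a.toProd = (w, x)) ∧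
      (b.toProd = (x, y) ∨ b.toProd = (y, z) ∨ b.toProd = (z, w) ∨ b.toProd = (w, x)) ∧
      NotMin elt x y z w a.edge ∧ NotMin elt x y z w b.edge) ↔
    ∃ x y z w, Square G x y z w ∧ a.toProd = (x, y) ∧
      (b.toProd = (y, z) ∨ b.toProd = (z, w) ∨ b.toProd = (w, x)) ∧
      NotMin elt x y z w a.edge ∧ NotMin elt x y z w b.edge := by
  have key : ∀ x y z w, Square G x y z w → a.toProd = (x, y) →
      (b.toProd = (x, y) ∨ b.toProd = (y, z) ∨ b.toProd = (z, w) ∨ b.toProd = (w, x)) →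
      NotMin elt x y z w a.edge → NotMin elt x y z w b.edge →
      ∃ x y z w, Square G x y z w ∧ a.toProd = (x, y) ∧
        (b.toProd = (y, z) ∨ b.toProd = (z, w) ∨ b.toProd = (w, x)) ∧
        NotMin elt x y z w a.edge ∧ NotMin elt x y z w b.edge :=
    fun x y z w h ha hb hea heb => ⟨x, y, z, w, h, ha,
      hb.resolve_left fun hb => hab (Dart.ext _ _ (ha.trans hb.symm)), hea, heb⟩
  constructor
  · rintro ⟨x, y, z, w, h, ha, hb, hea, heb⟩
    rcases ha with ha | ha | ha | ha
    · exact key x y z w h ha hb hea heb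
    · exact key y z w x h.rotate ha (by tauto) hea.rotate heb.rotate
    · exact key z w x y h.rotate.rotate ha (by tauto) hea.rotate.rotate heb.rotate.rotate
    · exact key w x y z h.rotate.rotate.rotate ha (by tauto) hea.rotate.rotate.rotate
        heb.rotate.rotate.rotate
  · rintro ⟨x, y, z, w, h, ha, hb, hea, heb⟩
    exact ⟨x, y, z, w, h, Or.inl ha, Or.inr hb, hea, heb⟩

lemma badPair_comm {a b : G.Dart} : BadPair G elt a b ↔ BadPair G elt b a := by
  have key : ∀ a b : G.Dart, BadPair G elt a b → BadPair G elt b a := by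
    rintro a b ⟨h, h'⟩
    refine ⟨h.symm, ?_⟩
    rcases h' with ⟨u, w, h1, h2, h3, h4⟩ | ⟨u, w, h1, h2, h3, h4, h5, h6⟩
    · exact Or.inl ⟨u, w, h1, h2, h4, h3⟩
    · exact Or.inr ⟨u, w, h1, h2, h4, h3, h6, h5⟩
  exact ⟨key a b, key b a⟩

lemma badPair_iff {a b : G.Dart} : BadPair G elt a b ↔
    (a.snd = b.fst ∧ BadMid G elt a.fst a.snd b.snd) ∨
    (b.snd = a.fst ∧ BadMid G elt b.fst b.snd a.snd) ∨
    BadOpposite G elt a.fst a.snd b.fst b.snd := by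
  unfold BadPair
  rw [exists_cycle_four_iff, dartsInCycle_three_iff]
  obtain ⟨⟨a₁, a₂⟩, ha⟩ := a
  obtain ⟨⟨b₁, b₂⟩, hb⟩ := b
  change G.Adj a₁ a₂ at ha
  change G.Adj b₁ b₂ at hb
  constructor
  · rintro ⟨hne, h⟩
    have hab : (⟨(a₁, a₂), ha⟩ : G.Dart) ≠ ⟨(b₁, b₂), hb⟩ := fun h => hne (by rw [h])
    rw [exists_square_iff hab] at h
    simp only [Dart.edge_mk, ne_eq, Sym2.eq_iff, Prod.mk.injEq, not_or, not_and] at hne h ⊢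
    rcases h with ⟨x, y, z, ⟨h1, h2, h3⟩, h4, h5⟩ | ⟨x, y, z, w, hs, ⟨rfl, rfl⟩, h4, h5, h6⟩
    · have h1' := h1.symm
      have h2' := h2.symm
      have h3' := h3.symm
      have := h1.ne
      have := h2.ne
      have := h3.ne
      unfold BadMid
      rcases h4 with ⟨rfl, rfl⟩ | ⟨rfl, rfl⟩ | ⟨rfl, rfl⟩ <;>
        rcases h5 with ⟨rfl, rfl⟩ | ⟨rfl, rfl⟩ | ⟨rfl, rfl⟩ <;> simp_all [ne_comm]
    · rcases h4 with ⟨rfl, rfl⟩ | ⟨rfl, rfl⟩ | ⟨rfl, rfl⟩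
      · exact Or.inl ⟨rfl, ⟨hs.fst, hs.snd, hs.ne₁⟩, Or.inr ⟨w, hs, h5, h6⟩⟩
      · exact Or.inr (Or.inr ⟨hs, h5, h6⟩)
      · refine Or.inr (Or.inl ⟨rfl, ⟨hs.fth, hs.fst, hs.ne₂.symm⟩, Or.inr ⟨z, ?_⟩⟩)
        exact ⟨hs.rotate.rotate.rotate, h6.rotate.rotate.rotate, h5.rotate.rotate.rotate⟩
  · have key : ∀ x y z, BadMid G elt x y z → s(x, y) ≠ s(y, z) := by
      rintro x y z ⟨⟨h1, h2, h3⟩, -⟩ h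
      rw [Sym2.eq_iff] at h
      rcases h with h | h
      · exact h1.ne h.1
      · exact h3 h.1
    simp only [Dart.edge_mk]
    rintro (⟨rfl, h⟩ | ⟨rfl, h⟩ | ⟨hs, h1, h2⟩)
    · refine ⟨key _ _ _ h, ?_⟩
      obtain ⟨⟨h1, h2, h3⟩, h4 | ⟨w, hs, h5, h6⟩⟩ := h
      · exact Or.inl ⟨_, _, _, ⟨h1, h2, h4.symm⟩, by simp, by simp⟩
      · exact Or.inr ⟨_, _, _, w, hs, by simp, by simp, h5, h6⟩
    · refine ⟨(key _ _ _ h).symm, ?_⟩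
      obtain ⟨⟨h1, h2, h3⟩, h4 | ⟨w, hs, h5, h6⟩⟩ := h
      · exact Or.inl ⟨_, _, _, ⟨h1, h2, h4.symm⟩, by simp, by simp⟩
      · exact Or.inr ⟨_, _, _, w, hs, by simp, by simp, h6, h5⟩
    · refine ⟨?_, Or.inr ⟨_, _, _, _, hs, by simp, by simp, h1, h2⟩⟩
      intro h
      rw [Sym2.eq_iff] at h
      rcases h with h | h
      · exact hs.ne₁ h.1
      · exact hs.fth.ne h.1.symm

end BadPairs

section Counting

variable {V : Type*} [Fintype V] {G : SimpleGraph V} {elt : Sym2 V → Sym2 V → Prop}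
  [IsStrictTotalOrder (Sym2 V) elt] {x y z w : V}

lemma exists_min {S : Set (Sym2 V)} (hS : S.Nonempty) :
    ∃ m ∈ S, ∀ e ∈ S, (e ≠ m → elt m e) ∧ ∀ f ∈ S, elt f e → e ≠ m := by
  have hwf : WellFounded elt := Finite.wellFounded_of_trans_of_irrefl elt
  obtain ⟨m, hm, h⟩ := hwf.has_min S hS
  refine ⟨m, hm, fun e he => ⟨fun hem => ?_, fun f hf hfe hem => h f hf (hem ▸ hfe)⟩⟩
  rcases trichotomous_of elt m e with h1 | h1 | h1
  · exact h1
  · exact absurd h1.symm hem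
  · exact absurd h1 (h e he)

open Classical in
/-- The middle vertices of the 2-paths from `x` to `z` that form a bad pair. -/
noncomputable def badMids (G : SimpleGraph V) (elt : Sym2 V → Sym2 V → Prop) (x z : V) :
    Finset V := {y | BadMid G elt x y z}

omit [IsStrictTotalOrder (Sym2 V) elt] in
lemma mem_badMids : y ∈ badMids G elt x z ↔ BadMid G elt x y z := by
  simp [badMids]

lemma card_badMids (hxz : x ≠ z) : (badMids G elt x z).card = badPaths G x z := by
  classical
  by_cases hadj : G.Adj x z
  · rw [badPaths_of_adj hadj]
    congr 1
    ext y
    simp [mem_badMids, BadMid, hadj, hxz, G.adj_comm y z]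
  · rw [badPaths_of_not_adj hadj]
    by_cases hC : ∃ y, G.Adj x y ∧ G.Adj y z
    · obtain ⟨y₁, hy₁⟩ := hC
      obtain ⟨m, ⟨y₀, hy₀, hm⟩, hmin⟩ := exists_min (elt := elt)
        (S := {e | ∃ y, (G.Adj x y ∧ G.Adj y z) ∧ (e = s(x, y) ∨ e = s(y, z))})
        ⟨s(x, y₁), y₁, hy₁, Or.inl rfl⟩
      have hmem : y₀ ∈ commonNbrs G x z := mem_commonNbrs.2 ⟨hy₀.1, hy₀.2.symm⟩
      rw [← card_erase_of_mem hmem]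
      congr 1
      ext y
      rw [mem_badMids, Finset.mem_erase, mem_commonNbrs, G.adj_comm z y]
      constructor
      · rintro ⟨⟨h1, h2, -⟩, h3⟩
        refine ⟨?_, h1, h2⟩
        rintro rfl
        obtain ⟨w, hs, ⟨f, hf, hfe⟩, ⟨g, hg, hge⟩⟩ := h3.resolve_left hadj
        have hsub : ∀ f ∈ ({s(x, y), s(y, z), s(z, w), s(w, x)} : Set (Sym2 V)),
            ∃ y, (G.Adj x y ∧ G.Adj y z) ∧ (f = s(x, y) ∨ f = s(y, z)) := by
          rintro f (rfl | rfl | rfl | rfl)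
          · exact ⟨y, ⟨h1, h2⟩, Or.inl rfl⟩
          · exact ⟨y, ⟨h1, h2⟩, Or.inr rfl⟩
          · exact ⟨w, ⟨hs.fth.symm, hs.trd.symm⟩, Or.inr Sym2.eq_swap⟩
          · exact ⟨w, ⟨hs.fth.symm, hs.trd.symm⟩, Or.inl Sym2.eq_swap⟩
        rcases hm with rfl | rfl
        · exact (hmin _ (hsub _ (by simp))).2 f (hsub f hf) hfe rfl
        · exact (hmin _ (hsub _ (by simp))).2 g (hsub g hg) hge rfl
      · rintro ⟨hne, h1, h2⟩
        have hs : Square G x y z y₀ := ⟨h1, h2, hy₀.2.symm, hy₀.1.symm, hxz, hne⟩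
        have hm' : m ∈ ({s(x, y), s(y, z), s(z, y₀), s(y₀, x)} : Set (Sym2 V)) := by
          rcases hm with rfl | rfl <;> simp [Sym2.eq_swap]
        refine ⟨⟨h1, h2, hxz⟩, Or.inr ⟨y₀, hs, ⟨m, hm', ?_⟩, ⟨m, hm', ?_⟩⟩⟩
        · refine (hmin _ ⟨y, ⟨h1, h2⟩, Or.inl rfl⟩).1 ?_
          have := hy₀.1.ne
          rcases hm with rfl | rfl <;> simp only [ne_eq, Sym2.eq_iff] <;> tauto
        · refine (hmin _ ⟨y, ⟨h1, h2⟩, Or.inr rfl⟩).1 ?_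
          have := hy₀.2.ne
          rcases hm with rfl | rfl <;> simp only [ne_eq, Sym2.eq_iff] <;> grind
    · have h1 : badMids G elt x z = ∅ := by
        rw [Finset.eq_empty_iff_forall_notMem]
        intro y hy
        exact hC ⟨y, (mem_badMids.1 hy).1.1, (mem_badMids.1 hy).1.2.1⟩
      have h2 : commonNbrs G x z = ∅ := by
        rw [Finset.eq_empty_iff_forall_notMem]
        intro y hy
        rw [mem_commonNbrs] at hy
        exact hC ⟨y, hy.1, hy.2.symm⟩
      rw [h1, h2]
      rfl

omit [Fintype V] in
lemma Square.edges_nodup (h : Square G x y z w) :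
    s(x, y) ≠ s(y, z) ∧ s(x, y) ≠ s(z, w) ∧ s(x, y) ≠ s(w, x) ∧ s(y, z) ≠ s(z, w) ∧
      s(y, z) ≠ s(w, x) ∧ s(z, w) ≠ s(w, x) := by
  obtain ⟨h1, h2, h3, h4, h5, h6⟩ := h
  have := h1.ne
  have := h2.ne
  have := h3.ne
  have := h4.ne
  simp only [ne_eq, Sym2.eq_iff]
  grind

lemma Square.badOpposite_rotate (h : Square G x y z w) :
    BadOpposite G elt y z w x ↔ ¬ BadOpposite G elt x y z w := by
  obtain ⟨m, hm, hmin⟩ := exists_min (elt := elt)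
    (S := {s(x, y), s(y, z), s(z, w), s(w, x)}) ⟨s(x, y), by simp⟩
  have key : ∀ e ∈ ({s(x, y), s(y, z), s(z, w), s(w, x)} : Set (Sym2 V)),
      (NotMin elt x y z w e ↔ e ≠ m) := fun e he =>
    ⟨fun ⟨f, hf, hfe⟩ => (hmin e he).2 f hf hfe, fun hem => ⟨m, hm, (hmin e he).1 hem⟩⟩
  have key' : ∀ e, NotMin elt y z w x e ↔ NotMin elt x y z w e := fun e =>
    ⟨fun h => h.rotate.rotate.rotate, fun h => h.rotate⟩
  have h' := h.edges_nodup
  simp only [BadOpposite, h, h.rotate, true_and, key']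
  rw [key _ (by simp), key _ (by simp), key _ (by simp), key _ (by simp)]
  simp only [Set.mem_insert_iff, Set.mem_singleton_iff] at hm
  grind

end Counting

section Total

variable {V : Type*} [Fintype V]

open Classical in
lemma card_square (G : SimpleGraph V) :
    ((({t | Square G t.1 t.2.1 t.2.2.1 t.2.2.2} : Finset (V × V × V × V)).card : ℕ) : ℤ) =
      ∑ x, ∑ z, if x = z then (0 : ℤ) else
        (commonNbrs G x z).card * ((commonNbrs G x z).card - 1) := by
  have h : ({t | Square G t.1 t.2.1 t.2.2.1 t.2.2.2} : Finset (V × V × V × V)).card =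
      (Finset.univ.sigma fun p : V × V =>
        if p.1 = p.2 then ∅ else (commonNbrs G p.1 p.2).offDiag).card := by
    refine Finset.card_bij (fun t _ => ⟨(t.1, t.2.2.1), (t.2.1, t.2.2.2)⟩) ?_ ?_ ?_
    · rintro ⟨x, y, z, w⟩ ht
      have ht := (Finset.mem_filter.1 ht).2
      simp only [Finset.mem_sigma, Finset.mem_univ, true_and, ht.ne₁, if_false, mem_offDiag,
        mem_commonNbrs]
      exact ⟨⟨ht.fst, ht.snd.symm⟩, ⟨ht.fth.symm, ht.trd⟩, ht.ne₂⟩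
    · rintro ⟨x, y, z, w⟩ - ⟨x', y', z', w'⟩ - h
      simp only [Sigma.mk.injEq, Prod.mk.injEq, heq_eq_eq] at h
      simp [h]
    · rintro ⟨⟨x, z⟩, ⟨y, w⟩⟩ h
      simp only [Finset.mem_sigma, Finset.mem_univ, true_and] at h
      by_cases hxz : x = z
      · simp [hxz] at h
      · simp only [hxz, if_false, mem_offDiag, mem_commonNbrs] at h
        exact ⟨(x, y, z, w), Finset.mem_filter.2 ⟨Finset.mem_univ _,
          ⟨h.1.1, h.1.2.symm, h.2.1.2, h.2.1.1.symm, hxz, h.2.2⟩⟩, rfl⟩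
  rw [h, Finset.card_sigma, Fintype.sum_prod_type]
  push_cast
  refine Finset.sum_congr rfl fun x _ => Finset.sum_congr rfl fun z _ => ?_
  split_ifs with hxz
  · simp
  · rw [offDiag_card]
    push_cast [Nat.cast_sub (Nat.le_mul_self _)]
    ring

variable (G : SimpleGraph V) (elt : Sym2 V → Sym2 V → Prop)

open Classical in
lemma card_badPair : ({p | BadPair G elt p.1 p.2} : Finset (G.Dart × G.Dart)).card =
    2 * ({p | p.1.snd = p.2.fst ∧ BadMid G elt p.1.fst p.1.snd p.2.snd} :
      Finset (G.Dart × G.Dart)).card +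
    ({p | BadOpposite G elt p.1.fst p.1.snd p.2.fst p.2.snd} : Finset (G.Dart × G.Dart)).card := by
  have h1 : ({p | p.2.snd = p.1.fst ∧ BadMid G elt p.2.fst p.2.snd p.1.snd} :
      Finset (G.Dart × G.Dart)).card = ({p | p.1.snd = p.2.fst ∧
        BadMid G elt p.1.fst p.1.snd p.2.snd} : Finset (G.Dart × G.Dart)).card :=
    Finset.card_bij (fun p _ => p.swap) (fun p hp => by simpa using hp)
      (fun p _ q _ h => Prod.swap_injective h) (fun p hp => ⟨p.swap, by simpa using hp, by simp⟩)
  have h2 : ({p | BadPair G elt p.1 p.2} : Finset (G.Dart × G.Dart)) =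
      ({p | p.1.snd = p.2.fst ∧ BadMid G elt p.1.fst p.1.snd p.2.snd} : Finset _) ∪
      (({p | p.2.snd = p.1.fst ∧ BadMid G elt p.2.fst p.2.snd p.1.snd} : Finset _) ∪
      ({p | BadOpposite G elt p.1.fst p.1.snd p.2.fst p.2.snd} : Finset _)) := by
    ext p
    simp only [Finset.mem_union, Finset.mem_filter, Finset.mem_univ, true_and, badPair_iff]
  rw [h2, card_union_of_disjoint, card_union_of_disjoint, h1]
  · ring
  · rw [Finset.disjoint_left]
    intro p hp hp'
    rw [Finset.mem_filter] at hp hp'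
    exact hp'.2.1.fth.ne hp.2.1
  · rw [Finset.disjoint_left]
    intro p hp hp'
    rw [Finset.mem_union, Finset.mem_filter, Finset.mem_filter] at hp'
    rw [Finset.mem_filter] at hp
    rcases hp' with hp' | hp'
    · exact hp.2.2.1.2.2 hp'.2.1.symm
    · exact hp'.2.1.snd.ne hp.2.1

variable [IsStrictTotalOrder (Sym2 V) elt]

open Classical in
lemma card_badMid : ({p | p.1.snd = p.2.fst ∧ BadMid G elt p.1.fst p.1.snd p.2.snd} :
    Finset (G.Dart × G.Dart)).card = ∑ x, ∑ z, if x = z then 0 else badPaths G x z := by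
  have h : ({p | p.1.snd = p.2.fst ∧ BadMid G elt p.1.fst p.1.snd p.2.snd} :
      Finset (G.Dart × G.Dart)).card =
      (Finset.univ.sigma fun p : V × V => badMids G elt p.1 p.2).card := by
    refine Finset.card_bij (fun p _ => ⟨(p.1.fst, p.2.snd), p.1.snd⟩) ?_ ?_ ?_
    · intro p hp
      simp only [Finset.mem_sigma, Finset.mem_univ, true_and, mem_badMids]
      exact (Finset.mem_filter.1 hp).2.2
    · rintro ⟨p₁, p₂⟩ hp ⟨q₁, q₂⟩ hq h
      have hp := (Finset.mem_filter.1 hp).2.1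
      have hq := (Finset.mem_filter.1 hq).2.1
      simp only [Sigma.mk.injEq, Prod.mk.injEq, heq_eq_eq] at h hp hq ⊢
      exact ⟨Dart.ext _ _ (Prod.ext h.1.1 h.2),
        Dart.ext _ _ (Prod.ext (hp.symm.trans (h.2.trans hq)) h.1.2)⟩
    · rintro ⟨⟨x, z⟩, y⟩ h
      simp only [Finset.mem_sigma, Finset.mem_univ, true_and, mem_badMids] at h
      exact ⟨(⟨(x, y), h.1.1⟩, ⟨(y, z), h.1.2.1⟩), Finset.mem_filter.2 ⟨Finset.mem_univ _, rfl, h⟩,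
        rfl⟩
  rw [h, Finset.card_sigma, Fintype.sum_prod_type]
  refine Finset.sum_congr rfl fun x _ => Finset.sum_congr rfl fun z _ => ?_
  split_ifs with hxz
  · rw [Finset.card_eq_zero, Finset.eq_empty_iff_forall_notMem]
    intro y hy
    exact (mem_badMids.1 hy).1.2.2 hxz
  · exact card_badMids hxz

open Classical in
lemma card_badOpposite : 2 * ({p | BadOpposite G elt p.1.fst p.1.snd p.2.fst p.2.snd} :
    Finset (G.Dart × G.Dart)).card =
    ({t | Square G t.1 t.2.1 t.2.2.1 t.2.2.2} : Finset (V × V × V × V)).card := by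
  have h1 : ({p | BadOpposite G elt p.1.fst p.1.snd p.2.fst p.2.snd} :
      Finset (G.Dart × G.Dart)).card = ({t | Square G t.1 t.2.1 t.2.2.1 t.2.2.2 ∧
        BadOpposite G elt t.1 t.2.1 t.2.2.1 t.2.2.2} : Finset (V × V × V × V)).card := by
    refine Finset.card_bij (fun p _ => (p.1.fst, p.1.snd, p.2.fst, p.2.snd)) ?_ ?_ ?_
    · intro p hp
      have hp := (Finset.mem_filter.1 hp).2
      exact Finset.mem_filter.2 ⟨Finset.mem_univ _, hp.1, hp⟩
    · rintro ⟨p₁, p₂⟩ - ⟨q₁, q₂⟩ - h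
      simp only [Prod.mk.injEq] at h ⊢
      exact ⟨Dart.ext _ _ (Prod.ext h.1 h.2.1), Dart.ext _ _ (Prod.ext h.2.2.1 h.2.2.2)⟩
    · rintro ⟨x, y, z, w⟩ ht
      have ht := (Finset.mem_filter.1 ht).2
      exact ⟨(⟨(x, y), ht.1.fst⟩, ⟨(z, w), ht.1.trd⟩),
        Finset.mem_filter.2 ⟨Finset.mem_univ _, ht.2⟩, rfl⟩
  have h2 : ({t | Square G t.1 t.2.1 t.2.2.1 t.2.2.2 ∧
        BadOpposite G elt t.1 t.2.1 t.2.2.1 t.2.2.2} : Finset (V × V × V × V)).card =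
      ({t | Square G t.1 t.2.1 t.2.2.1 t.2.2.2 ∧
        ¬ BadOpposite G elt t.1 t.2.1 t.2.2.1 t.2.2.2} : Finset (V × V × V × V)).card := by
    refine Finset.card_bij (fun t _ => (t.2.1, t.2.2.1, t.2.2.2, t.1)) ?_ ?_ ?_
    · intro t ht
      have ht := (Finset.mem_filter.1 ht).2
      exact Finset.mem_filter.2 ⟨Finset.mem_univ _, ht.1.rotate, fun h =>
        ht.1.badOpposite_rotate.1 h ht.2⟩
    · rintro ⟨x, y, z, w⟩ - ⟨x', y', z', w'⟩ - h
      simp only [Prod.mk.injEq] at h ⊢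
      tauto
    · rintro ⟨x, y, z, w⟩ ht
      have ht := (Finset.mem_filter.1 ht).2
      refine ⟨(w, x, y, z), Finset.mem_filter.2 ⟨Finset.mem_univ _, ht.1.rotate.rotate.rotate, ?_⟩,
        rfl⟩
      by_contra h
      exact ht.2 (ht.1.rotate.rotate.rotate.badOpposite_rotate.2 h)
  rw [two_mul, h1]
  nth_rw 2 [h2]
  rw [← Finset.filter_filter, ← Finset.filter_filter]
  exact Finset.card_filter_add_card_filter_not _

omit [IsStrictTotalOrder (Sym2 V) elt] in
lemma two_mul_n1 : 2 * n1 G elt = (open Classical in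
    ({p | BadPair G elt p.1 p.2} : Finset (G.Dart × G.Dart)).card) := by
  classical
  let H : SimpleGraph G.Dart :=
    { Adj := BadPair G elt
      symm := ⟨fun _ _ => badPair_comm.1⟩
      loopless := ⟨fun _ h => h.1 rfl⟩ }
  have h1 : n1 G elt = H.edgeSet.ncard := by
    unfold n1
    congr 1
    ext e
    induction e using Sym2.ind with
    | _ a b =>
    simp only [Set.mem_ofPred_eq, mem_edgeSet, Sym2.eq_iff]
    constructor
    · rintro ⟨a', b', h, ⟨rfl, rfl⟩ | ⟨rfl, rfl⟩⟩
      · exact h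
      · exact badPair_comm.1 h
    · exact fun h => ⟨a, b, h, Or.inl ⟨rfl, rfl⟩⟩
  rw [h1, ← card_adjPairs_univ]
  congr 1

theorem four_mul_n1 : 4 * (n1 G elt : ℤ) = score G := by
  classical
  have h1 := two_mul_n1 G elt
  have h2 := card_badPair G elt
  have h3 := card_badMid G elt
  have h4 := card_badOpposite G elt
  have h5 := card_square G
  have h6 : score G = ∑ x, ∑ z, (if x = z then (0 : ℤ) else
        (commonNbrs G x z).card * ((commonNbrs G x z).card - 1)) +
      4 * ((∑ x, ∑ z, if x = z then 0 else badPaths G x z : ℕ) : ℤ) := by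
    push_cast
    simp_rw [Finset.mul_sum]
    rw [← Finset.sum_add_distrib]
    simp_rw [← Finset.sum_add_distrib]
    refine Finset.sum_congr rfl fun x _ => Finset.sum_congr rfl fun z _ => ?_
    by_cases hxz : x = z
    · simp [hxz]
    · simp [pairScore_of_ne, hxz]
  rw [h6, ← h5, ← h3, ← h4]
  push_cast
  omega

end Total

section TwoConnected

variable {V : Type*} {G : SimpleGraph V} {a b x y : V}

lemma TwoConnected.exists_ne (hG : TwoConnected G) (x y : V) : ∃ z, z ≠ x ∧ z ≠ y := by
  classical
  by_contra! h
  have hsub : (Set.univ : Set V) ⊆ {x, y} := fun z _ => by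
    by_cases hz : z = x
    · exact Or.inl hz
    · exact Or.inr (h z hz)
  have h1 := Set.ncard_le_ncard hsub (by simp)
  have h2 := Set.ncard_insert_le x {y}
  rw [Set.ncard_univ] at h1
  rw [Set.ncard_singleton] at h2
  have := hG.2.1
  omega

lemma TwoConnected.reachable (hG : TwoConnected G) (h : G.Adj x y) :
    (G.deleteEdges {s(x, y)}).Reachable x y := by
  have key : ∀ v ∈ s(x, y), ∀ p q, p ≠ v → q ≠ v → (G.deleteEdges {s(x, y)}).Reachable p q := by
    intro v hv p q hp hq
    let f : G.induce {u | u ≠ v} →g G.deleteEdges {s(x, y)} :=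
      ⟨Subtype.val, fun {p q} hpq => by
        rw [deleteEdges_adj]
        refine ⟨hpq, fun he => ?_⟩
        rw [Set.mem_singleton_iff] at he
        rw [← he, Sym2.mem_iff] at hv
        rcases hv with hv | hv
        · exact p.2 hv.symm
        · exact q.2 hv.symm⟩
    exact ((hG.2.2 v).preconnected ⟨p, hp⟩ ⟨q, hq⟩).map f
  obtain ⟨z, hzx, hzy⟩ := hG.exists_ne x y
  exact (key y (by simp) x z h.ne hzy).trans (key x (by simp) z y hzx h.ne.symm)

lemma TwoConnected.exists_adj_ne (hG : TwoConnected G) (hxy : x ≠ y) : ∃ z, G.Adj x z ∧ z ≠ y := by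
  obtain ⟨z, hzx, hzy⟩ := hG.exists_ne x y
  have : Nontrivial {u | u ≠ y} := ⟨⟨x, hxy⟩, ⟨z, hzy⟩, fun h => hzx (congrArg Subtype.val h).symm⟩
  obtain ⟨w, hw⟩ := (hG.2.2 y).preconnected.exists_adj_of_nontrivial ⟨x, hxy⟩
  exact ⟨w, hw, w.2⟩

lemma TwoConnected.exists_adj (hG : TwoConnected G) (x : V) : ∃ z, G.Adj x z := by
  obtain ⟨y, hy, -⟩ := hG.exists_ne x x
  obtain ⟨z, hz, -⟩ := hG.exists_adj_ne hy.symm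
  exact ⟨z, hz⟩

lemma TwoConnected.cyc_eq (hG : TwoConnected G) :
    cyc G = (G.edgeSet.ncard : ℤ) + 1 - Nat.card V := by
  have := hG.1.preconnected.subsingleton_connectedComponent
  have := hG.1.nonempty
  have h : Nat.card G.ConnectedComponent = 1 :=
    Nat.card_eq_one_iff_unique.2 ⟨inferInstance, inferInstance⟩
  unfold cyc
  rw [h]
  rfl

lemma TwoConnected.cyc_pos [Fintype V] (hG : TwoConnected G) : 0 < cyc G := by
  have := hG.1.nonempty
  obtain ⟨y, hy⟩ := hG.exists_adj (Classical.arbitrary V)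
  have h1 := cyc_deleteEdges_of_reachable hy (hG.reachable hy)
  have h2 := cyc_nonneg (G.deleteEdges {s(Classical.arbitrary V, y)})
  omega

/-- The neighbours of every vertex other than `a` and `b` are exactly `a` and `b`. -/
structure Suspension (G : SimpleGraph V) (a b : V) : Prop where
  ne : a ≠ b
  adj : ∀ x, x ≠ a → x ≠ b → G.Adj a x ∧ G.Adj b x
  not_adj : ∀ x y, x ≠ a → x ≠ b → y ≠ a → y ≠ b → ¬ G.Adj x y

lemma TwoConnected.suspension (hG : TwoConnected G) (hab : a ≠ b)
    (h : ∀ x y, x ≠ a → x ≠ b → y ≠ a → y ≠ b → ¬ G.Adj x y) : Suspension G a b := by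
  refine ⟨hab, fun x hxa hxb => ⟨?_, ?_⟩, h⟩
  · obtain ⟨z, hz, hzb⟩ := hG.exists_adj_ne hxb
    by_cases hza : z = a
    · exact hza ▸ hz.symm
    · exact absurd hz (h x z hxa hxb hza hzb)
  · obtain ⟨z, hz, hza⟩ := hG.exists_adj_ne hxa
    by_cases hzb : z = b
    · exact hzb ▸ hz.symm
    · exact absurd hz (h x z hxa hxb hza hzb)

lemma TwoConnected.suspension_of_saturatedPair [Fintype V] (hG : TwoConnected G)
    (h : SaturatedPair G a b) : Suspension G a b := by
  classical
  obtain ⟨hab, h⟩ := h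
  have haT : a ∉ commonNbrs G a b := by simp
  have hbT : b ∉ commonNbrs G a b := by simp
  have h1 := card_adjPairs_insert_ge hbT subset_rfl
    (fun y hy => ((mem_commonNbrs.1 hy).2 : G.Adj b y))
  have h2 := card_adjPairs_insert_ge (G := G) (u := a) (K := insert b (commonNbrs G a b))
    (T := commonNbrs G a b) (by simp [hab]) (Finset.subset_insert _ _)
    (fun y hy => (mem_commonNbrs.1 hy).1)
  have h3 := fun hadj : G.Adj a b => card_adjPairs_insert_insert hadj haT hbT
    (fun y hy => ⟨hy, (mem_commonNbrs.1 hy).1⟩) (fun y hy => ⟨hy, (mem_commonNbrs.1 hy).2⟩)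
  have h4 := card_insert_insert hab haT hbT
  have h5 := card_adjPairs_le_cyc G (Finset.insert_nonempty a (insert b (commonNbrs G a b)))
  have h6 : (adjPairs G (commonNbrs G a b) (commonNbrs G a b)).card = 0 ∧
      2 * cyc G + 2 * (insert a (insert b (commonNbrs G a b))).card ≤
        (adjPairs G (insert a (insert b (commonNbrs G a b)))
          (insert a (insert b (commonNbrs G a b)))).card + 2 := by
    rcases h with h | ⟨hadj, h⟩
    · omega
    · have := h3 hadj
      omega
  have hcov : ∀ x, x ≠ a → x ≠ b → x ∈ commonNbrs G a b := fun x hxa hxb => by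
    obtain ⟨y, hy⟩ := hG.exists_adj x
    have := mem_of_cyc_le (Finset.insert_nonempty _ _) (fun x y hxy => hG.reachable hxy) h6.2 hy
    simpa only [Finset.mem_insert, hxa, hxb, false_or] using this
  refine ⟨hab, fun x hxa hxb => mem_commonNbrs.1 (hcov x hxa hxb), ?_⟩
  intro x y hxa hxb hya hyb hxy
  have h7 : (x, y) ∈ adjPairs G (commonNbrs G a b) (commonNbrs G a b) :=
    mem_adjPairs.2 ⟨⟨hcov x hxa hxb, hcov y hya hyb⟩, hxy⟩
  rw [Finset.card_eq_zero.1 h6.1] at h7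
  simp at h7

lemma TwoConnected.card_eq_four [Fintype V] (hG : TwoConnected G) (hc : cyc G = 3) {s : Finset V}
    (hs : G.IsNClique 4 s) : Fintype.card V = 4 := by
  classical
  have h1 : s.offDiag ⊆ adjPairs G s s := fun p hp => by
    rw [mem_offDiag] at hp
    exact mem_adjPairs.2 ⟨⟨hp.1, hp.2.1⟩, hs.1 hp.1 hp.2.1 hp.2.2⟩
  have h2 := card_le_card h1
  rw [offDiag_card, hs.2] at h2
  have hne : s.Nonempty := Finset.card_pos.1 (by rw [hs.2]; norm_num)
  have hcov : s = univ := by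
    rw [Finset.eq_univ_iff_forall]
    intro x
    obtain ⟨y, hy⟩ := hG.exists_adj x
    refine mem_of_cyc_le hne (fun x y hxy => hG.reachable hxy) ?_ hy
    rw [hs.2, hc]
    norm_num at h2 ⊢
    omega
  rw [← hs.2, hcov, Finset.card_univ]

end TwoConnected

section Suspension

variable {V : Type*} [Fintype V] {G : SimpleGraph V} {a b : V}

namespace Suspension

lemma sum_eq (h : Suspension G a b) {f : V → V → ℤ} {q r s : ℤ} (hself : ∀ x, f x x = 0)
    (hcomm : ∀ x y, f x y = f y x) (hab : f a b = s)
    (hq : ∀ x, x ≠ a → x ≠ b → f a x = q ∧ f b x = q)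
    (hr : ∀ x y, x ≠ a → x ≠ b → y ≠ a → y ≠ b → x ≠ y → f x y = r) :
    ∑ x, ∑ y, f x y = 2 * s + (Fintype.card V - 2) * (4 * q + (Fintype.card V - 3) * r) := by
  classical
  set T : Finset V := (univ.erase b).erase a with hT
  have hmem : ∀ x ∈ T, x ≠ a ∧ x ≠ b := by simp [hT]
  have huniv : (univ : Finset V) = insert a (insert b T) := by
    ext x
    simp [hT]
    tauto
  have haT : a ∉ insert b T := by simp [hT, h.ne]
  have hbT : b ∉ T := by simp [hT]
  have hcard : Fintype.card V = T.card + 2 := by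
    rw [← Finset.card_univ, huniv, card_insert_of_notMem haT, card_insert_of_notMem hbT]
  have hsum : ∀ g : V → ℤ, ∑ x, g x = g a + g b + ∑ x ∈ T, g x := fun g => by
    rw [huniv, Finset.sum_insert haT, Finset.sum_insert hbT, add_assoc]
  have hconst : ∀ (g : V → ℤ) (c : ℤ), (∀ x ∈ T, g x = c) → ∑ x ∈ T, g x = T.card * c :=
    fun g c hg => by rw [Finset.sum_congr rfl hg, Finset.sum_const, nsmul_eq_mul]
  have ha := hconst (f a) q fun x hx => (hq x (hmem x hx).1 (hmem x hx).2).1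
  have hb := hconst (f b) q fun x hx => (hq x (hmem x hx).1 (hmem x hx).2).2
  have hin : ∀ x ∈ T, ∑ y, f x y = 2 * q + (T.card - 1) * r := fun x hx => by
    have h1 := hq x (hmem x hx).1 (hmem x hx).2
    rw [hsum, hcomm x a, hcomm x b, h1.1, h1.2, ← Finset.add_sum_erase _ _ hx, hself,
      Finset.sum_congr rfl (fun y hy => hr x y (hmem x hx).1 (hmem x hx).2
        (hmem y (Finset.mem_of_mem_erase hy)).1 (hmem y (Finset.mem_of_mem_erase hy)).2
        (Finset.ne_of_mem_erase hy).symm), Finset.sum_const, card_erase_of_mem hx, nsmul_eq_mul]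
    push_cast [Nat.cast_sub (Finset.card_pos.2 ⟨x, hx⟩)]
    ring
  rw [hsum, hsum, hsum, ha, hb, hconst _ _ hin, hself, hself, hcomm b a, hab, hcard]
  push_cast
  ring

lemma cyc_eq (h : Suspension G a b) (hG : TwoConnected G) : (G.Adj a b → cyc G =
    Fintype.card V - 2) ∧ (¬ G.Adj a b → cyc G = Fintype.card V - 3) := by
  classical
  have h1 : ((adjPairs G univ univ).card : ℤ) = ∑ x, ∑ y, if G.Adj x y then 1 else 0 := by
    rw [← Fintype.sum_prod_type', Finset.sum_boole]
    congr 2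
  rw [h.sum_eq (q := 1) (r := 0) (s := if G.Adj a b then 1 else 0) (by simp)
    (fun x y => by simp [G.adj_comm]) rfl (fun x hxa hxb => by simp [h.adj x hxa hxb])
    (fun x y hxa hxb hya hyb _ => by simp [h.not_adj x y hxa hxb hya hyb]),
    card_adjPairs_univ] at h1
  rw [hG.cyc_eq, Nat.card_eq_fintype_card]
  push_cast at h1
  constructor
  · intro hadj
    rw [if_pos hadj] at h1
    linarith
  · intro hadj
    rw [if_neg hadj] at h1
    linarith

lemma score_eq (h : Suspension G a b) (hG : TwoConnected G) :
    score G = 8 * cyc G * (cyc G + 2) := by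
  classical
  have hT : commonNbrs G a b = (univ.erase b).erase a := by
    ext x
    rw [mem_commonNbrs]
    simp only [Finset.mem_erase, Finset.mem_univ, and_true]
    exact ⟨fun hx => ⟨hx.1.ne.symm, hx.2.ne.symm⟩, fun hx => h.adj x hx.1 hx.2⟩
  have hk : (commonNbrs G a b).card = Fintype.card V - 2 := by
    rw [hT, card_erase_of_mem (by simp [h.ne]), card_erase_of_mem (by simp), Finset.card_univ]
    rfl
  have hn : 3 ≤ Fintype.card V := by
    rw [← Nat.card_eq_fintype_card]
    exact hG.2.1
  have hr : ∀ x y, x ≠ a → x ≠ b → y ≠ a → y ≠ b → x ≠ y → pairScore G x y = 6 := by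
    intro x y hxa hxb hya hyb hxy
    have h1 : commonNbrs G x y = {a, b} := by
      ext z
      rw [mem_commonNbrs, Finset.mem_insert, Finset.mem_singleton]
      constructor
      · rintro ⟨hz, -⟩
        by_contra! hzn
        exact h.not_adj x z hxa hxb hzn.1 hzn.2 hz
      · rintro (rfl | rfl)
        · exact ⟨(h.adj x hxa hxb).1.symm, (h.adj y hya hyb).1.symm⟩
        · exact ⟨(h.adj x hxa hxb).2.symm, (h.adj y hya hyb).2.symm⟩
    rw [pairScore_of_ne hxy, badPaths_of_not_adj (h.not_adj x y hxa hxb hya hyb), h1,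
      Finset.card_pair h.ne]
    norm_num
  have hsub : ∀ c d : V, (∀ x, x ≠ c → x ≠ d → G.Adj c x ∧ G.Adj d x) →
      (∀ x y, x ≠ c → x ≠ d → y ≠ c → y ≠ d → ¬ G.Adj x y) → ∀ x, x ≠ c → x ≠ d →
      pairScore G c x = if G.Adj c d then 4 else 0 := by
    intro c d hadj hnot x hxc hxd
    have h1 : commonNbrs G c x = if G.Adj c d then {d} else ∅ := by
      ext z
      rw [mem_commonNbrs]
      constructor
      · rintro ⟨h1, h2⟩
        have hzd : z = d := by
          by_contra hzd
          exact hnot x z hxc hxd h1.ne.symm hzd h2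
        subst hzd
        simp [h1]
      · split_ifs with hcd
        · rw [Finset.mem_singleton]
          rintro rfl
          exact ⟨hcd, (hadj x hxc hxd).2.symm⟩
        · simp
    rw [pairScore_of_ne hxc.symm, badPaths_of_adj (hadj x hxc hxd).1, h1]
    split_ifs <;> simp
  have hq : ∀ x, x ≠ a → x ≠ b → pairScore G a x = (if G.Adj a b then 4 else 0) ∧
      pairScore G b x = (if G.Adj a b then 4 else 0) := fun x hxa hxb => by
    refine ⟨hsub a b h.adj h.not_adj x hxa hxb, ?_⟩
    simp only [G.adj_comm a b]
    exact hsub b a (fun x h1 h2 => (h.adj x h2 h1).symm)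
      (fun x y h1 h2 h3 h4 => h.not_adj x y h2 h1 h4 h3) x hxb hxa
  unfold score
  rw [h.sum_eq (fun x => pairScore_self) (fun x y => pairScore_comm x y) rfl hq hr,
    pairScore_of_ne h.ne]
  obtain ⟨h1, h2⟩ := h.cyc_eq hG
  by_cases hadj : G.Adj a b
  · rw [h1 hadj, if_pos hadj, badPaths_of_adj hadj, hk]
    push_cast [Nat.cast_sub (show 2 ≤ Fintype.card V by omega)]
    ring
  · rw [h2 hadj, if_neg hadj, badPaths_of_not_adj hadj, hk, Nat.sub_sub]
    push_cast [Nat.cast_sub (show 2 ≤ Fintype.card V by omega), Nat.cast_sub hn]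
    ring

end Suspension

end Suspension

section Small

variable {V : Type*} [Fintype V] {G : SimpleGraph V}

lemma TwoConnected.score_eq_of_card_eq_three (hG : TwoConnected G) (hV : Fintype.card V = 3) :
    score G = 8 * cyc G * (cyc G + 2) := by
  classical
  have := hG.1.nonempty
  set x := Classical.arbitrary V
  have h1 : (univ.erase x).card = 2 := by
    rw [card_erase_of_mem (Finset.mem_univ x), Finset.card_univ, hV]
  obtain ⟨a, b, hab, h2⟩ := card_eq_two.1 h1
  have h3 : ∀ y, y ≠ a → y ≠ b → y = x := fun y hya hyb => by
    by_contra hyx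
    have : y ∈ univ.erase x := Finset.mem_erase.2 ⟨hyx, Finset.mem_univ y⟩
    simp [h2, hya, hyb] at this
  refine (hG.suspension hab fun y z hya hyb hza hzb hyz => hyz.ne ?_).score_eq hG
  rw [h3 y hya hyb, h3 z hza hzb]

lemma TwoConnected.score_eq_of_card_eq_four (hG : TwoConnected G) (hV : Fintype.card V = 4) :
    score G = 8 * cyc G * (cyc G + 2) := by
  classical
  have h1 : ∀ x y : V, x ≠ y → ((univ.erase x).erase y).card = 2 := fun x y hxy => by
    rw [card_erase_of_mem (by simp [hxy.symm]), card_erase_of_mem (Finset.mem_univ x),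
      Finset.card_univ, hV]
  by_cases hcomplete : ∀ x y, x ≠ y → G.Adj x y
  · have hsum : ∀ c : ℤ, ∑ x : V, ∑ y : V, (if x = y then 0 else c) = 12 * c := fun c => by
      have h2 : ∀ x : V, ∑ y : V, (if x = y then 0 else c) = 3 * c := fun x => by
        rw [← Finset.add_sum_erase _ _ (Finset.mem_univ x), if_pos rfl,
          Finset.sum_congr rfl fun y hy => if_neg (Finset.ne_of_mem_erase hy).symm,
          Finset.sum_const, card_erase_of_mem (Finset.mem_univ x), Finset.card_univ, hV]
        simp
      rw [Finset.sum_congr rfl fun x _ => h2 x, Finset.sum_const, Finset.card_univ, hV]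
      simp only [nsmul_eq_mul]
      push_cast
      ring
    have hscore : score G = 120 := by
      have h2 : ∀ x y, pairScore G x y = if x = y then 0 else 10 := fun x y => by
        split_ifs with hxy
        · rw [hxy, pairScore_self]
        · have h3 : commonNbrs G x y = (univ.erase x).erase y := by
            ext z
            simp only [mem_commonNbrs, Finset.mem_erase, Finset.mem_univ, and_true]
            exact ⟨fun h => ⟨h.2.ne.symm, h.1.ne.symm⟩,
              fun h => ⟨hcomplete x z h.2.symm, hcomplete y z h.1.symm⟩⟩
          rw [pairScore_of_ne hxy, badPaths_of_adj (hcomplete x y hxy), h3, h1 x y hxy]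
          norm_num
      simp only [score, h2, hsum]
      norm_num
    have hcyc : cyc G = 3 := by
      have h2 : G = ⊤ := by
        ext x y
        exact ⟨fun h => h.ne, fun h => hcomplete x y h⟩
      have h3 : G.edgeSet.ncard = 6 := by
        have h4 := card_edgeFinset_top_eq_card_choose_two (V := V)
        rw [← Set.ncard_coe_finset, coe_edgeFinset, hV] at h4
        rw [h2, h4]
        rfl
      rw [hG.cyc_eq, h3, Nat.card_eq_fintype_card, hV]
      norm_num
    rw [hscore, hcyc]
    norm_num
  · push Not at hcomplete
    obtain ⟨x, y, hxy, hadj⟩ := hcomplete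
    obtain ⟨a, b, hab, h2⟩ := card_eq_two.1 (h1 x y hxy)
    have h3 : ∀ z, z ≠ a → z ≠ b → z = x ∨ z = y := fun z hza hzb => by
      by_contra! hz
      have : z ∈ (univ.erase x).erase y := by simp [hz]
      simp [h2, hza, hzb] at this
    refine (hG.suspension hab fun z w hza hzb hwa hwb hzw => ?_).score_eq hG
    rcases h3 z hza hzb with rfl | rfl <;> rcases h3 w hwa hwb with rfl | rfl
    · exact hzw.ne rfl
    · exact hadj hzw
    · exact hadj hzw.symm
    · exact hzw.ne rfl

end Small

section Iso

variable {n : ℕ} {G : SimpleGraph (Fin n)} {a b : Fin n}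

lemma gnGraph_adj {x y : Fin n} :
    (GnGraph n).Adj x y ↔ x ≠ y ∧ (x.val < 2 ∨ y.val < 2) := by
  simp [GnGraph, fromRel_adj]

lemma k2Graph_adj {x y : Fin n} :
    (K2Graph n).Adj x y ↔ (x.val < 2 ∧ 2 ≤ y.val) ∨ (y.val < 2 ∧ 2 ≤ x.val) := by
  simp only [K2Graph, fromRel_adj, and_iff_right_iff_imp]
  rintro h rfl
  omega

lemma exists_perm_val_lt_two_iff (hab : a ≠ b) :
    ∃ σ : Equiv.Perm (Fin n), ∀ x, (σ x).val < 2 ↔ x = a ∨ x = b := by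
  have hn : 2 ≤ n := by
    have := a.2
    have := b.2
    have := Fin.val_ne_of_ne hab
    omega
  obtain ⟨p, hp⟩ : ∃ p : Fin n, p.val = 0 := ⟨⟨0, by omega⟩, rfl⟩
  obtain ⟨q, hq⟩ : ∃ q : Fin n, q.val = 1 := ⟨⟨1, by omega⟩, rfl⟩
  have hpq : p ≠ q := fun h => by
    rw [h, hq] at hp
    exact one_ne_zero hp
  set τ := Equiv.swap a p
  have hτ : τ b ≠ p := fun h => hab (τ.injective (by rw [h, Equiv.swap_apply_left]))
  let σ := τ.trans (Equiv.swap (τ b) q)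
  have ha : σ a = p := by
    simp only [σ, Equiv.trans_apply, τ, Equiv.swap_apply_left]
    exact Equiv.swap_apply_of_ne_of_ne hτ.symm hpq
  have hb : σ b = q := by simp [σ]
  refine ⟨σ, fun x => ?_⟩
  rw [← σ.injective.eq_iff, ← σ.injective.eq_iff (a := x) (b := b), ha, hb, Fin.ext_iff,
    Fin.ext_iff, hp, hq]
  omega

namespace Suspension

lemma adj_iff (h : Suspension G a b) {x y : Fin n} : G.Adj x y ↔
    x ≠ y ∧ ((x = a ∨ x = b) ∧ ¬ (y = a ∨ y = b) ∨ (y = a ∨ y = b) ∧ ¬ (x = a ∨ x = b) ∨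
      (x = a ∨ x = b) ∧ (y = a ∨ y = b) ∧ G.Adj a b) := by
  by_cases hxy : x = y
  · simp [hxy]
  by_cases hxa : x = a <;> by_cases hxb : x = b <;> by_cases hya : y = a <;> by_cases hyb : y = b
  all_goals
    have := h.ne
    have := h.adj x
    have := h.adj y
    have := h.not_adj x y
    have := G.adj_comm x y
    grind [SimpleGraph.adj_comm]

lemma nonempty_iso (h : Suspension G a b) :
    Nonempty (G ≃g GnGraph n) ∨ Nonempty (G ≃g K2Graph n) := by
  obtain ⟨σ, hσ⟩ := exists_perm_val_lt_two_iff h.ne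
  by_cases hadj : G.Adj a b
  · refine Or.inl ⟨⟨σ, fun {x y} => ?_⟩⟩
    rw [gnGraph_adj, hσ, hσ, h.adj_iff, σ.injective.ne_iff]
    tauto
  · refine Or.inr ⟨⟨σ, fun {x y} => ?_⟩⟩
    rw [k2Graph_adj, ← not_lt, ← not_lt, hσ, hσ, h.adj_iff]
    have : x = y → (x = a ∨ x = b ↔ y = a ∨ y = b) := fun h => by rw [h]
    tauto

end Suspension

lemma suspension_of_iso (hn : 2 ≤ n)
    (h : Nonempty (G ≃g GnGraph n) ∨ Nonempty (G ≃g K2Graph n)) :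
    ∃ a b, Suspension G a b := by
  have key : ∀ {H : SimpleGraph (Fin n)} (e : G ≃g H),
      (∀ x y : Fin n, x.val < 2 → 2 ≤ y.val → H.Adj x y) →
      (∀ x y : Fin n, 2 ≤ x.val → 2 ≤ y.val → ¬ H.Adj x y) → ∃ a b, Suspension G a b := by
    intro H e h1 h2
    have hval : ∀ x, x ≠ e.symm ⟨0, by omega⟩ → x ≠ e.symm ⟨1, by omega⟩ → 2 ≤ (e x).val := by
      intro x hx0 hx1
      have h0 : (e x).val ≠ 0 := fun h => hx0 (by
        rw [← e.symm_apply_apply x]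
        exact congrArg e.symm (Fin.ext h))
      have h1 : (e x).val ≠ 1 := fun h => hx1 (by
        rw [← e.symm_apply_apply x]
        exact congrArg e.symm (Fin.ext h))
      omega
    refine ⟨e.symm ⟨0, by omega⟩, e.symm ⟨1, by omega⟩, ?_, fun x hx0 hx1 => ?_, ?_⟩
    · exact e.symm.injective.ne (by simp)
    · rw [← e.map_adj_iff, ← e.map_adj_iff, e.apply_symm_apply, e.apply_symm_apply]
      exact ⟨h1 _ _ (by simp) (hval x hx0 hx1), h1 _ _ (by simp) (hval x hx0 hx1)⟩
    · intro x y hx0 hx1 hy0 hy1 hxy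
      exact h2 _ _ (hval x hx0 hx1) (hval y hy0 hy1) (e.map_adj_iff.2 hxy)
  rcases h with ⟨⟨e⟩⟩ | ⟨⟨e⟩⟩
  · refine key e (fun x y hx hy => gnGraph_adj.2 ⟨fun h => ?_, Or.inl hx⟩) fun x y hx hy hxy => ?_
    · rw [h] at hx
      omega
    · have := (gnGraph_adj.1 hxy).2
      omega
  · refine key e (fun x y hx hy => k2Graph_adj.2 (Or.inl ⟨hx, hy⟩)) fun x y hx hy hxy => ?_
    have := k2Graph_adj.1 hxy
    omega

end Iso

open Filter in
theorem stmt8 {n : ℕ} (G : SimpleGraph (Fin n)) (hG : TwoConnected G)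
    (elt : Sym2 (Fin n) → Sym2 (Fin n) → Prop)
    (hord : IsStrictTotalOrder (Sym2 (Fin n)) elt) :
    gammaTwo G elt = 0 ↔
      n < 5 ∨ (5 ≤ n ∧ (Nonempty (G ≃g GnGraph n) ∨ Nonempty (G ≃g K2Graph n))) := by
  have hn : 3 ≤ n := by simpa using hG.2.1
  have := hG.1.nonempty
  have hscore : gammaTwo G elt = 0 ↔ score G = 8 * cyc G * (cyc G + 2) := by
    have := four_mul_n1 G elt
    unfold gammaTwo
    constructor <;> intro h <;> linarith
  rw [hscore]
  constructor
  · intro h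
    rcases (score_le G).2 h with hc | ⟨a, b, hab⟩ | ⟨hc, s, hs⟩
    · exact absurd hc hG.cyc_pos.ne'
    · refine (lt_or_ge n 5).imp_right fun h5 => ⟨h5, ?_⟩
      exact (hG.suspension_of_saturatedPair hab).nonempty_iso
    · have := hG.card_eq_four hc hs
      rw [Fintype.card_fin] at this
      omega
  · rintro (h | ⟨h, hiso⟩)
    · have : n = 3 ∨ n = 4 := by omega
      rcases this with h3 | h4
      · exact hG.score_eq_of_card_eq_three (by simpa using h3)
      · exact hG.score_eq_of_card_eq_four (by simpa using h4)
    · obtain ⟨a, b, hab⟩ := suspension_of_iso (by omega) hiso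
      exact hab.score_eq hG

end SEP
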